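/- arXiv:0806.0434 — 3 statements merged into one kernel-verified Lean document; each statement's English description precedes it below -/
import Mathlib

section
/- Let n ≥ 3 and S ⊆ [n] with CP_n(S) ≠ ∅. If |S| < ⌊(n−1)/2⌋, then CP_{n+1}(S ∪ {n+1}) ≠ ∅. If |S| = ⌊(n−1)/2⌋, then CP_{n+1}(S ∪ {n+1}) ≠ ∅ when n is even and CP_{n+1}(S ∪ {n+1}) = ∅ when n is odd. -/
open Finset Polynomial

/-- `σ` is a permutation of `[n] = {1, …, n}` (viewed as a function `ℕ → ℕ`
restricted to a bijection of `{1, …, n}` onto itself). -/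
def IsPermOn (n : ℕ) (σ : ℕ → ℕ) : Prop :=
  Set.BijOn σ (Set.Icc 1 n) (Set.Icc 1 n)

/-- The circular peak set of `σ` (as a permutation of `[n]`):
`CP(σ) = {σ(i) : 2 ≤ i ≤ n−1, σ(i−1) < σ(i) > σ(i+1)}`. -/
def CP (n : ℕ) (σ : ℕ → ℕ) : Finset ℕ :=
  ((Finset.Icc 2 (n - 1)).filter (fun i => σ (i - 1) < σ i ∧ σ (i + 1) < σ i)).image σ

open scoped Classical in
/-- `Pn n` is the collection of all subsets `S ⊆ [n]` arising as the circular peak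
set of some permutation of `[n]`. -/
noncomputable def Pn (n : ℕ) : Finset (Finset ℕ) :=
  (Finset.Icc 1 n).powerset.filter (fun S => ∃ σ : ℕ → ℕ, IsPermOn n σ ∧ CP n σ = S)

/-- `pcount n k` is the number of members of `Pn n` of cardinality `k`;
in the paper's notation, `p_{n,i} = pcount n (i+1)`. -/
noncomputable def pcount (n k : ℕ) : ℕ :=
  ((Pn n).filter (fun S => S.card = k)).card

/-- The f-polynomial `P_n(x) = Σ_{i=0}^{⌊(n−1)/2⌋} p_{n,i−1} x^{⌊(n−1)/2⌋−i}`. -/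
noncomputable def fpoly (n : ℕ) : Polynomial ℚ :=
  ∑ i ∈ Finset.range ((n - 1) / 2 + 1),
    Polynomial.C (pcount n i : ℚ) * Polynomial.X ^ ((n - 1) / 2 - i)

/-- The positions of the (interior) peaks of `σ`. -/
def peakPos (n : ℕ) (σ : ℕ → ℕ) : Finset ℕ :=
  (Finset.Icc 2 (n - 1)).filter (fun i => σ (i - 1) < σ i ∧ σ (i + 1) < σ i)

lemma mem_peakPos {n : ℕ} {σ : ℕ → ℕ} {i : ℕ} :
    i ∈ peakPos n σ ↔ (2 ≤ i ∧ i ≤ n - 1) ∧ σ (i - 1) < σ i ∧ σ (i + 1) < σ i := by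
  simp [peakPos]

lemma mem_CP {n : ℕ} {σ : ℕ → ℕ} {x : ℕ} : x ∈ CP n σ ↔ ∃ i ∈ peakPos n σ, σ i = x := by
  simp [CP, peakPos]

lemma card_CP {n : ℕ} {σ : ℕ → ℕ} (h : IsPermOn n σ) : (CP n σ).card = (peakPos n σ).card := by
  refine Finset.card_image_of_injOn (h.injOn.mono fun i hi => ?_)
  have := mem_peakPos.1 (Finset.mem_coe.1 hi)
  exact ⟨by omega, by omega⟩

/-- A permutation of `[n]` has at most `(n - 1) / 2` peaks, since peaks are never adjacent. -/
lemma two_mul_card_CP_le {n : ℕ} {σ : ℕ → ℕ} (h : IsPermOn n σ) : 2 * (CP n σ).card ≤ n - 1 := by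
  rw [card_CP h]
  have hd : Disjoint (peakPos n σ) ((peakPos n σ).image (· + 1)) := by
    rw [Finset.disjoint_left]
    intro i hi hi'
    obtain ⟨j, hj, rfl⟩ := Finset.mem_image.1 hi'
    have h₁ := (mem_peakPos.1 hi).2.1
    have h₂ := (mem_peakPos.1 hj).2.2
    rw [Nat.add_sub_cancel] at h₁
    omega
  have hsub : peakPos n σ ∪ (peakPos n σ).image (· + 1) ⊆ Finset.Icc 2 n := by
    intro i hi
    simp only [Finset.mem_union, Finset.mem_image, mem_peakPos, Finset.mem_Icc] at hi ⊢
    rcases hi with hi | ⟨j, hj, rfl⟩ <;> omega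
  have hc := Finset.card_le_card hsub
  rw [Finset.card_union_of_disjoint hd, Finset.card_image_of_injective _ (add_left_injective 1),
    Nat.card_Icc] at hc
  omega

/-- If there are few peaks, some two adjacent positions `j - 1`, `j` are both not peaks. -/
lemma exists_gap {n : ℕ} {σ : ℕ → ℕ} (hc : 2 * (peakPos n σ).card < n - 1) :
    ∃ j, 2 ≤ j ∧ j ≤ n ∧ j ∉ peakPos n σ ∧ j - 1 ∉ peakPos n σ := by
  have hlt : (peakPos n σ ∪ (peakPos n σ).image (· + 1)).card < (Finset.Icc 2 n).card := by
    have h₁ := Finset.card_union_le (peakPos n σ) ((peakPos n σ).image (· + 1))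
    have h₂ := Finset.card_image_le (s := peakPos n σ) (f := (· + 1))
    rw [Nat.card_Icc]
    omega
  obtain ⟨j, hj, hj'⟩ := Finset.exists_mem_notMem_of_card_lt_card hlt
  rw [Finset.mem_Icc] at hj
  rw [Finset.mem_union, not_or] at hj'
  refine ⟨j, hj.1, hj.2, hj'.1, fun h => hj'.2 (Finset.mem_image.2 ⟨j - 1, h, ?_⟩)⟩
  omega

/-- Insert the value `a` at position `j` of the word `σ`. -/
def insertAt (σ : ℕ → ℕ) (j a : ℕ) (m : ℕ) : ℕ :=
  if m < j then σ m else if m = j then a else σ (m - 1)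

lemma insertAt_of_lt {σ : ℕ → ℕ} {j a m : ℕ} (h : m < j) : insertAt σ j a m = σ m := by
  simp [insertAt, h]

lemma insertAt_self {σ : ℕ → ℕ} {j a : ℕ} : insertAt σ j a j = a := by
  simp [insertAt]

lemma insertAt_of_gt {σ : ℕ → ℕ} {j a m : ℕ} (h : j < m) : insertAt σ j a m = σ (m - 1) := by
  simp [insertAt, h.not_gt, h.ne']

lemma IsPermOn.insertAt {n j : ℕ} {σ : ℕ → ℕ} (h : IsPermOn n σ) (hj : 1 ≤ j) (hjn : j ≤ n + 1) :
    IsPermOn (n + 1) (insertAt σ j (n + 1)) := by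
  have hm : ∀ i, 1 ≤ i → i ≤ n → 1 ≤ σ i ∧ σ i ≤ n := fun i h₁ h₂ => h.mapsTo ⟨h₁, h₂⟩
  have hi : ∀ i k, 1 ≤ i → i ≤ n → 1 ≤ k → k ≤ n → σ i = σ k → i = k :=
    fun i k h₁ h₂ h₃ h₄ e => h.injOn ⟨h₁, h₂⟩ ⟨h₃, h₄⟩ e
  refine ⟨?_, ?_, ?_⟩
  · rintro i ⟨h₁, h₂⟩
    rw [Set.mem_Icc]
    unfold _root_.insertAt
    grind
  · rintro i ⟨h₁, h₂⟩ k ⟨h₃, h₄⟩ e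
    have hi₁ := hm i
    have hi₂ := hm (i - 1)
    have hk₁ := hm k
    have hk₂ := hm (k - 1)
    unfold _root_.insertAt at e
    split_ifs at e
    · exact hi i k h₁ (by omega) h₃ (by omega) e
    · omega
    · have := hi i (k - 1) h₁ (by omega) (by omega) (by omega) e
      omega
    · omega
    · omega
    · omega
    · have := hi (i - 1) k (by omega) (by omega) h₃ (by omega) e
      omega
    · omega
    · have := hi (i - 1) (k - 1) (by omega) (by omega) (by omega) (by omega) e
      omega
  · rintro y ⟨h₁, h₂⟩
    rcases Nat.lt_or_ge n y with hy | hy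
    · exact ⟨j, ⟨hj, hjn⟩, by rw [insertAt_self]; omega⟩
    · obtain ⟨i, ⟨hi₁, hi₂⟩, rfl⟩ := h.surjOn ⟨h₁, hy⟩
      rcases Nat.lt_or_ge i j with hij | hij
      · exact ⟨i, ⟨hi₁, by omega⟩, insertAt_of_lt hij⟩
      · exact ⟨i + 1, ⟨by omega, by omega⟩, by rw [insertAt_of_gt (by omega), Nat.add_sub_cancel]⟩

/-- Inserting a new maximum between two adjacent non-peaks adds exactly one peak. -/
lemma CP_insertAt {n j : ℕ} {σ : ℕ → ℕ} (h : IsPermOn n σ) (hj : 2 ≤ j) (hjn : j ≤ n)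
    (hp : j ∉ peakPos n σ) (hp' : j - 1 ∉ peakPos n σ) :
    CP (n + 1) (insertAt σ j (n + 1)) = insert (n + 1) (CP n σ) := by
  have hm : ∀ i, 1 ≤ i → i ≤ n → σ i < n + 1 :=
    fun i h₁ h₂ => Nat.lt_succ_of_le (h.mapsTo ⟨h₁, h₂⟩).2
  ext x
  rw [Finset.mem_insert, mem_CP, mem_CP]
  constructor
  · rintro ⟨i, hi, rfl⟩
    obtain ⟨⟨h₁, h₂⟩, h₃, h₄⟩ := mem_peakPos.1 hi
    rcases lt_trichotomy i j with hij | rfl | hij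
    · right
      have hne : i + 1 ≠ j := by
        rintro rfl
        rw [insertAt_self, insertAt_of_lt hij] at h₄
        have := hm i (by omega) (by omega)
        omega
      rw [insertAt_of_lt hij] at h₃ h₄ ⊢
      rw [insertAt_of_lt (by omega)] at h₃ h₄
      exact ⟨i, mem_peakPos.2 ⟨by omega, h₃, h₄⟩, rfl⟩
    · exact Or.inl insertAt_self
    · right
      have hne : i - 1 ≠ j := by
        rintro rfl
        rw [insertAt_self, insertAt_of_gt hij] at h₃
        have := hm (i - 1) (by omega) (by omega)
        omega
      rw [insertAt_of_gt hij] at h₃ h₄ ⊢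
      rw [insertAt_of_gt (by omega)] at h₃ h₄
      refine ⟨i - 1, mem_peakPos.2 ⟨by omega, h₃, ?_⟩, rfl⟩
      rwa [show i - 1 + 1 = i + 1 - 1 by omega]
  · rintro (rfl | ⟨i, hi, rfl⟩)
    · refine ⟨j, mem_peakPos.2 ⟨by omega, ?_, ?_⟩, insertAt_self⟩
      · rw [insertAt_self, insertAt_of_lt (by omega)]
        exact hm _ (by omega) (by omega)
      · rw [insertAt_self, insertAt_of_gt (by omega)]
        exact hm _ (by omega) (by omega)
    · have hne : i ≠ j := by rintro rfl; exact hp hi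
      have hne' : i ≠ j - 1 := by rintro rfl; exact hp' hi
      obtain ⟨⟨h₁, h₂⟩, h₃, h₄⟩ := mem_peakPos.1 hi
      rcases Nat.lt_or_ge i j with hij | hij
      · refine ⟨i, mem_peakPos.2 ⟨by omega, ?_, ?_⟩, insertAt_of_lt hij⟩
        · rwa [insertAt_of_lt hij, insertAt_of_lt (by omega)]
        · rwa [insertAt_of_lt hij, insertAt_of_lt (by omega)]
      · have e : insertAt σ j (n + 1) (i + 1) = σ i := by
          rw [insertAt_of_gt (by omega), Nat.add_sub_cancel]
        refine ⟨i + 1, mem_peakPos.2 ⟨by omega, ?_, ?_⟩, e⟩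
        · rwa [e, insertAt_of_gt (by omega), Nat.add_sub_cancel]
        · rwa [e, insertAt_of_gt (by omega), Nat.add_sub_cancel]

lemma exists_CP_eq_insert {n : ℕ} {σ : ℕ → ℕ} (h : IsPermOn n σ)
    (hc : 2 * (CP n σ).card < n - 1) :
    ∃ τ : ℕ → ℕ, IsPermOn (n + 1) τ ∧ CP (n + 1) τ = insert (n + 1) (CP n σ) := by
  rw [card_CP h] at hc
  obtain ⟨j, hj, hjn, hp, hp'⟩ := exists_gap hc
  exact ⟨_, h.insertAt (by omega) (by omega), CP_insertAt h hj hjn hp hp'⟩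

/-- Corollary 2.2: if `CP_n(S) ≠ ∅` then: when `|S| < ⌊(n−1)/2⌋`,
`CP_{n+1}(S ∪ {n+1}) ≠ ∅`; when `|S| = ⌊(n−1)/2⌋`, `CP_{n+1}(S ∪ {n+1}) ≠ ∅`
if `n` is even and `CP_{n+1}(S ∪ {n+1}) = ∅` if `n` is odd. -/
theorem circular_peak_insert_top (n : ℕ) (hn : 3 ≤ n) (S : Finset ℕ)
    (hS : S ⊆ Finset.Icc 1 n) (hne : ∃ σ : ℕ → ℕ, IsPermOn n σ ∧ CP n σ = S) :
    (S.card < (n - 1) / 2 →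
      ∃ σ : ℕ → ℕ, IsPermOn (n + 1) σ ∧ CP (n + 1) σ = insert (n + 1) S) ∧
    (S.card = (n - 1) / 2 →
      (Even n → ∃ σ : ℕ → ℕ, IsPermOn (n + 1) σ ∧ CP (n + 1) σ = insert (n + 1) S) ∧
      (Odd n → ¬ ∃ σ : ℕ → ℕ, IsPermOn (n + 1) σ ∧ CP (n + 1) σ = insert (n + 1) S)) := by
  obtain ⟨σ, hσ, rfl⟩ := hne
  refine ⟨fun hc => exists_CP_eq_insert hσ (by omega), fun hc => ⟨fun he => ?_, fun ho => ?_⟩⟩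
  · obtain ⟨k, rfl⟩ := he
    exact exists_CP_eq_insert hσ (by omega)
  · rintro ⟨τ, hτ, e⟩
    have hle := two_mul_card_CP_le hτ
    have hn' : n + 1 ∉ CP n σ := fun hmem => by
      have := Finset.mem_Icc.1 (hS hmem)
      omega
    rw [e, Finset.card_insert_of_notMem hn'] at hle
    obtain ⟨k, rfl⟩ := ho
    omega
end

section
/- Let n ≥ 3 and i ≥ 1. The number of strict chains S_1 ⊊ S_2 ⊊ ... ⊊ S_i of elements of P_n equals Σ multinomial(n; d_1, d_2, ..., d_{i+1}) · (2·d_{i+1} − n)/n, where the sum is over all (i+1)-tuples (d_1, ..., d_{i+1}) of integers with d_1 + d_2 + ... + d_{i+1} = n, d_1 ≥ 0, d_k ≥ 1 for 2 ≤ k ≤ i, and d_{i+1} ≥ n − ⌊(n−1)/2⌋. -/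
open Finset Polynomial

/-- Every initial segment `[m]` of `[n]` contains more elements outside `S` than in `S`. -/
def IsBallot (n : ℕ) (S : Finset ℕ) : Prop :=
  ∀ m, 1 ≤ m → m ≤ n → 2 * (S.filter (· ≤ m)).card < m

lemma isBallot_CP {n : ℕ} {σ : ℕ → ℕ} (hσ : IsPermOn n σ) : IsBallot n (CP n σ) := by
  intro m hm hmn
  set A := (Finset.Icc 2 (n - 1)).filter
    (fun i => (σ (i - 1) < σ i ∧ σ (i + 1) < σ i) ∧ σ i ≤ m) with hA
  have hcard : ((CP n σ).filter (· ≤ m)).card ≤ A.card := by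
    rw [CP, Finset.filter_image, Finset.filter_filter]
    exact Finset.card_image_le
  rcases A.eq_empty_or_nonempty with h | h
  · rw [h, Finset.card_empty] at hcard
    omega
  have memA : ∀ x, x ∈ A ↔ (2 ≤ x ∧ x ≤ n - 1) ∧ (σ (x - 1) < σ x ∧ σ (x + 1) < σ x) ∧ σ x ≤ m := by
    intro x
    rw [hA, Finset.mem_filter, Finset.mem_Icc]
  have hdisj : Disjoint A (A.image (· + 1)) := by
    rw [Finset.disjoint_left]
    intro x hx hx'
    obtain ⟨y, hy, rfl⟩ := Finset.mem_image.1 hx'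
    have h1 := (memA (y + 1)).1 hx
    have h2 := (memA _).1 hy
    simp only [Nat.add_sub_cancel] at h1
    omega
  have hmin := (memA _).1 (A.min'_mem h)
  have hnot : A.min' h - 1 ∉ A ∪ A.image (· + 1) := by
    intro hx
    rcases Finset.mem_union.1 hx with hx | hx
    · have := A.min'_le _ hx
      omega
    · obtain ⟨y, hy, hxy⟩ := Finset.mem_image.1 hx
      have := A.min'_le _ hy
      omega
  have hmap : ∀ x ∈ insert (A.min' h - 1) (A ∪ A.image (· + 1)),
      x ∈ Set.Icc 1 n ∧ σ x ≤ m := by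
    intro x hx
    rw [Set.mem_Icc]
    rcases Finset.mem_insert.1 hx with rfl | hx
    · omega
    rcases Finset.mem_union.1 hx with hx | hx
    · have := (memA _).1 hx
      omega
    · obtain ⟨y, hy, rfl⟩ := Finset.mem_image.1 hx
      have := (memA _).1 hy
      omega
  have hle := Finset.card_le_card_of_injOn (t := Finset.Icc 1 m) σ
    (fun x hx => by
      have := hmap x hx
      have h3 := hσ.mapsTo this.1
      rw [Set.mem_Icc] at h3
      exact Finset.mem_coe.2 (Finset.mem_Icc.2 ⟨h3.1, this.2⟩))
    (fun x hx y hy hxy => hσ.injOn (hmap x hx).1 (hmap y hy).1 hxy)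
  rw [Finset.card_insert_of_notMem hnot, Finset.card_union_of_disjoint hdisj,
    Finset.card_image_of_injective _ (add_left_injective 1), Nat.card_Icc] at hle
  omega

lemma count_notMem_add_count_mem {S : Finset ℕ} (h0 : 0 ∉ S) (a : ℕ) :
    Nat.count (fun x => 1 ≤ x ∧ x ∉ S) (a + 1) + Nat.count (· ∈ S) (a + 1) = a := by
  induction a with
  | zero => simp [Nat.count_succ, h0]
  | succ a ih =>
    rw [Nat.count_succ, Nat.count_succ (· ∈ S)]
    by_cases h : a + 1 ∈ S <;> simp [h] <;> omega

lemma count_mem_succ (S : Finset ℕ) (a : ℕ) :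
    Nat.count (· ∈ S) (a + 1) = (S.filter (· ≤ a)).card := by
  rw [Nat.count_eq_card_filter_range]
  congr 1
  ext x
  simp only [Finset.mem_filter, Finset.mem_range]
  grind

/-- The arrangement `c₀ s₀ c₁ s₁ ⋯ c_k c_{k+1} ⋯`, where `s` enumerates the `k` elements of `S`
and `c` enumerates the positive integers outside `S`. -/
noncomputable def peakArrangement (S : Finset ℕ) (i : ℕ) : ℕ :=
  if i % 2 = 0 ∧ i ≤ 2 * S.card then Nat.nth (· ∈ S) (i / 2 - 1)
  else Nat.nth (fun x => 1 ≤ x ∧ x ∉ S) (if i ≤ 2 * S.card then (i - 1) / 2 else i - S.card - 1)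

lemma exists_perm_of_isBallot {n : ℕ} (hn : 1 ≤ n) {S : Finset ℕ} (hS : S ⊆ Finset.Icc 1 n)
    (hb : IsBallot n S) : ∃ σ : ℕ → ℕ, IsPermOn n σ ∧ CP n σ = S := by
  classical
  have h0 : 0 ∉ S := fun h => by simpa using hS h
  have hSle : ∀ x ∈ S, 1 ≤ x ∧ x ≤ n := fun x hx => Finset.mem_Icc.1 (hS hx)
  set s := Nat.nth (· ∈ S)
  set c := Nat.nth (fun x => 1 ≤ x ∧ x ∉ S)
  set k := S.card with hk
  have hfin : (Set.ofPred (· ∈ S)).Finite := S.finite_toSet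
  have hfincard : hfin.toFinset.card = k := by
    rw [hk]; congr 1; ext; rw [Set.Finite.mem_toFinset]; rfl
  have hinf : (Set.ofPred (fun x => 1 ≤ x ∧ x ∉ S)).Infinite := by
    apply Set.infinite_of_not_bddAbove
    rintro ⟨b, hb⟩
    have := @hb (b + n + 1) ⟨by omega, fun h => by have := hSle _ h; omega⟩
    omega
  have hcmono : StrictMono c := Nat.nth_strictMono hinf
  have hcmem : ∀ j, 1 ≤ c j ∧ c j ∉ S := fun j => Nat.nth_mem_of_infinite hinf j
  have hsmem : ∀ j, j < k → s j ∈ S := fun j hj =>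
    Nat.nth_mem_of_lt_card hfin (hj.trans_eq hfincard.symm)
  have hscount : ∀ j, j < k → Nat.count (· ∈ S) (s j) = j := fun j hj =>
    Nat.count_nth (fun hf => by
      have : hf.toFinset.card = k := hfincard
      omega)
  have hsex : ∀ x ∈ S, ∃ j < k, s j = x := fun x hx => by
    obtain ⟨j, hj, hjx⟩ := Nat.exists_lt_card_finite_nth_eq hfin hx
    exact ⟨j, by rw [← hfincard]; exact hj, hjx⟩
  have h2k : 2 * k < n := by
    have := hb n hn le_rfl
    rwa [Finset.filter_true_of_mem fun x hx => (hSle x hx).2] at this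
  have hcs : ∀ j, j < k → c (j + 1) < s j := by
    intro j hj
    apply Nat.nth_lt_of_lt_count
    have h1 := hSle _ (hsmem j hj)
    have h2 := hb (s j) h1.1 h1.2
    rw [← count_mem_succ, Nat.count_succ, if_pos (hsmem j hj), hscount j hj] at h2
    have h3 := count_notMem_add_count_mem h0 (s j)
    rw [Nat.count_succ, Nat.count_succ (· ∈ S), if_pos (hsmem j hj), hscount j hj,
      if_neg (fun h => h.2 (hsmem j hj))] at h3
    omega
  have hcn : ∀ j, j < n - k → c j ≤ n := by
    intro j hj
    apply Nat.lt_succ_iff.1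
    apply Nat.nth_lt_of_lt_count
    rw [Nat.succ_eq_add_one]
    have h3 := count_notMem_add_count_mem h0 n
    rw [count_mem_succ, Finset.filter_true_of_mem fun x hx => (hSle x hx).2] at h3
    omega
  have hsinj : ∀ i j, i < k → j < k → s i = s j → i = j := by
    intro i j hi hj h
    rw [← hscount i hi, h, hscount j hj]
  have hev : ∀ i, i % 2 = 0 → i ≤ 2 * k → peakArrangement S i = s (i / 2 - 1) :=
    fun i h1 h2 => if_pos ⟨h1, h2⟩
  have hodd : ∀ i, i % 2 = 1 → i ≤ 2 * k → peakArrangement S i = c ((i - 1) / 2) :=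
    fun i h1 h2 => by
      rw [peakArrangement, if_neg (by omega), if_pos h2]
  have hbig : ∀ i, 2 * k < i → peakArrangement S i = c (i - k - 1) :=
    fun i h1 => by
      rw [peakArrangement, if_neg (by omega), if_neg (by omega)]
  have hcase : ∀ i, 1 ≤ i → i ≤ n →
      (i ≤ 2 * k ∧ ∃ j < k, i = 2 * j + 2 ∧ peakArrangement S i = s j) ∨
      (∃ j, j < n - k ∧ ((i ≤ 2 * k ∧ i = 2 * j + 1) ∨ (2 * k < i ∧ i = j + k + 1)) ∧
        peakArrangement S i = c j) := by
    intro i h1 h2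
    by_cases h : i ≤ 2 * k
    · rcases Nat.mod_two_eq_zero_or_one i with h' | h'
      · exact Or.inl ⟨h, i / 2 - 1, by omega, by omega, hev i h' h⟩
      · exact Or.inr ⟨(i - 1) / 2, by omega, by omega, hodd i h' h⟩
    · exact Or.inr ⟨i - k - 1, by omega, by omega, hbig i (by omega)⟩
  refine ⟨peakArrangement S, ?_, ?_⟩
  · have hm : Set.MapsTo (peakArrangement S) (Finset.Icc 1 n : Set ℕ) (Finset.Icc 1 n : Set ℕ) := by
      intro i hi
      simp only [Finset.coe_Icc, Set.mem_Icc] at hi ⊢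
      rcases hcase i hi.1 hi.2 with ⟨-, j, hj, -, h⟩ | ⟨j, hj, -, h⟩ <;> rw [h]
      · exact hSle _ (hsmem j hj)
      · exact ⟨(hcmem j).1, hcn j hj⟩
    have hi : Set.InjOn (peakArrangement S) (Finset.Icc 1 n : Set ℕ) := by
      intro i hi i' hi' h
      simp only [Finset.coe_Icc, Set.mem_Icc] at hi hi'
      rcases hcase i hi.1 hi.2 with ⟨-, j, hj, h1, h2⟩ | ⟨j, hj, h1, h2⟩ <;>
      rcases hcase i' hi'.1 hi'.2 with ⟨-, j', hj', h1', h2'⟩ | ⟨j', hj', h1', h2'⟩ <;>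
      rw [h2, h2'] at h
      · have := hsinj _ _ hj hj' h
        omega
      · exact absurd (h ▸ hsmem j hj) (hcmem j').2
      · exact absurd (h ▸ hsmem j' hj') (hcmem j).2
      · have := hcmono.injective h
        omega
    have hsurj := Finset.surjOn_of_injOn_of_card_le _ hm hi le_rfl
    rw [Finset.coe_Icc] at hm hi hsurj
    exact ⟨hm, hi, hsurj⟩
  · ext x
    simp only [CP, Finset.mem_image, Finset.mem_filter, Finset.mem_Icc]
    constructor
    · rintro ⟨i, ⟨⟨h1, h2⟩, h3, h4⟩, rfl⟩
      rcases hcase i (by omega) (by omega) with ⟨-, j, hj, -, h⟩ | ⟨j, hj, h5, h⟩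
      · rw [h]; exact hsmem j hj
      exfalso
      rcases h5 with ⟨h5, h6⟩ | ⟨h5, h6⟩
      · rw [hev (i - 1) (by omega) (by omega), h] at h3
        have := hcs ((i - 1) / 2 - 1) (by omega)
        rw [show (i - 1) / 2 - 1 + 1 = j by omega] at this
        omega
      · rw [hbig (i + 1) (by omega), h] at h4
        have := hcmono.lt_iff_lt.1 h4
        omega
    · intro hx
      obtain ⟨j, hj, rfl⟩ := hsex x hx
      have h1 : peakArrangement S (2 * j + 2) = s j := by
        rw [hev _ (by omega) (by omega)]
        congr 1
        omega
      have hcs' := hcs j hj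
      have hcj : c j < c (j + 1) := hcmono (Nat.lt_succ_self j)
      refine ⟨2 * j + 2, ⟨⟨by omega, by omega⟩, ?_, ?_⟩, h1⟩
      · rw [h1, hodd _ (by omega) (by omega), show (2 * j + 2 - 1 - 1) / 2 = j by omega]
        omega
      · rw [h1]
        by_cases hlast : 2 * j + 2 + 1 ≤ 2 * k
        · rw [hodd _ (by omega) hlast, show (2 * j + 2 + 1 - 1) / 2 = j + 1 by omega]
          exact hcs'
        · rw [hbig _ (by omega), show 2 * j + 2 + 1 - k - 1 = j + 1 by omega]
          exact hcs'

lemma mem_Pn_iff {n : ℕ} (hn : 1 ≤ n) (S : Finset ℕ) :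
    S ∈ Pn n ↔ S ⊆ Finset.Icc 1 n ∧ IsBallot n S := by
  simp only [Pn, Finset.mem_filter, Finset.mem_powerset]
  refine and_congr_right fun hS => ⟨?_, exists_perm_of_isBallot hn hS⟩
  rintro ⟨σ, hσ, rfl⟩
  exact isBallot_CP hσ

lemma IsBallot.two_mul_card_lt {n : ℕ} (hn : 1 ≤ n) {S : Finset ℕ} (hS : S ⊆ Finset.Icc 1 n)
    (h : IsBallot n S) : 2 * S.card < n := by
  have := h n hn le_rfl
  rwa [Finset.filter_true_of_mem fun x hx => (Finset.mem_Icc.1 (hS hx)).2] at this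

lemma isBallot_succ_iff {n : ℕ} {S : Finset ℕ} (hS : S ⊆ Finset.Icc 1 (n + 1)) :
    IsBallot (n + 1) S ↔ IsBallot n S ∧ 2 * S.card < n + 1 := by
  refine ⟨fun h => ⟨fun m h1 h2 => h m h1 (by omega), h.two_mul_card_lt (by omega) hS⟩, ?_⟩
  rintro ⟨h1, h2⟩ m hm hmn
  rcases Nat.lt_or_ge n m with h | h
  · have := Finset.card_filter_le S (· ≤ m)
    omega
  · exact h1 m hm h

lemma isBallot_insert_iff {n : ℕ} {S : Finset ℕ} :
    IsBallot n (insert (n + 1) S) ↔ IsBallot n S := by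
  refine forall_congr' fun m => forall_congr' fun _ => forall_congr' fun h => ?_
  rw [Finset.filter_insert, if_neg (by omega)]

open scoped Classical in
lemma mul_card_ballot (n k : ℕ) (hn : 1 ≤ n) (hk : 2 * k < n + 1) :
    (n * (((Finset.Icc 1 n).powersetCard k).filter (IsBallot n)).card : ℚ) =
      (n - 2 * k) * n.choose k := by
  induction n, hn using Nat.le_induction generalizing k with
  | base =>
    obtain rfl : k = 0 := by omega
    have : IsBallot 1 ∅ := fun m hm _ => by simpa using Nat.succ_le_iff.1 hm
    simp [Finset.filter_singleton, this]
  | succ n hn ih =>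
    rcases k with _ | k
    · have : IsBallot (n + 1) ∅ := fun m hm _ => by simpa using Nat.succ_le_iff.1 hm
      simp [Finset.filter_singleton, this]
    rcases Nat.lt_or_ge (2 * (k + 1)) (n + 1) with h | h
    · have hIcc : Finset.Icc 1 (n + 1) = insert (n + 1) (Finset.Icc 1 n) := by
        rw [Finset.insert_Icc_right_eq_Icc_add_one (by omega)]
      have hnot : n + 1 ∉ Finset.Icc 1 n := by simp
      have hdisj : Disjoint (((Finset.Icc 1 n).powersetCard (k + 1)).filter (IsBallot n))
          ((((Finset.Icc 1 n).powersetCard k).filter (IsBallot n)).image (insert (n + 1))) := by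
        rw [Finset.disjoint_left]
        intro S hS hS'
        obtain ⟨T, -, rfl⟩ := Finset.mem_image.1 hS'
        exact hnot ((Finset.mem_powersetCard.1 (Finset.mem_filter.1 hS).1).1
          (Finset.mem_insert_self _ _))
      have hsplit : ((Finset.Icc 1 (n + 1)).powersetCard (k + 1)).filter (IsBallot (n + 1)) =
          ((Finset.Icc 1 n).powersetCard (k + 1)).filter (IsBallot n) ∪
          (((Finset.Icc 1 n).powersetCard k).filter (IsBallot n)).image (insert (n + 1)) := by
        have : ((Finset.Icc 1 (n + 1)).powersetCard (k + 1)).filter (IsBallot (n + 1)) =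
            ((Finset.Icc 1 (n + 1)).powersetCard (k + 1)).filter (IsBallot n) := by
          refine Finset.filter_congr fun S hS => ?_
          rw [Finset.mem_powersetCard] at hS
          rw [isBallot_succ_iff hS.1, hS.2]
          exact and_iff_left h
        rw [this, hIcc, Finset.powersetCard_succ_insert hnot, Finset.filter_union,
          Finset.filter_image]
        simp only [isBallot_insert_iff]
      have hinj : Set.InjOn (insert (n + 1))
          (((Finset.Icc 1 n).powersetCard k).filter (IsBallot n) : Set (Finset ℕ)) := by
        have hm : ∀ S ∈ ((Finset.Icc 1 n).powersetCard k).filter (IsBallot n), n + 1 ∉ S :=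
          fun S hS h => hnot ((Finset.mem_powersetCard.1 (Finset.mem_filter.1 hS).1).1 h)
        intro S hS T hT h
        rw [← Finset.erase_insert (hm S hS), ← Finset.erase_insert (hm T hT), h]
      rw [hsplit, Finset.card_union_of_disjoint hdisj, Finset.card_image_of_injOn hinj]
      have h1 := ih (k + 1) (by omega)
      have h2 := ih k (by omega)
      have h3 : (k + 1 : ℚ) * n.choose (k + 1) = (n - k) * n.choose k := by
        have := Nat.choose_succ_right_eq n k
        rw [← Nat.cast_inj (R := ℚ)] at this
        push_cast [Nat.cast_sub (show k ≤ n by omega)] at this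
        linarith
      have hn0 : (n : ℚ) ≠ 0 := by positivity
      rw [Nat.choose_succ_succ]
      push_cast at h1 h2 ⊢
      rw [← mul_right_inj' hn0]
      linear_combination (n + 1 : ℚ) * h1 + (n + 1 : ℚ) * h2 - 2 * h3
    · have hempty : ((Finset.Icc 1 (n + 1)).powersetCard (k + 1)).filter (IsBallot (n + 1)) = ∅ := by
        refine Finset.filter_false_of_mem fun S hS hb => ?_
        rw [Finset.mem_powersetCard] at hS
        have := hb.two_mul_card_lt (by omega) hS.1
        omega
      have h5 : n = 2 * k + 1 := by omega
      rw [hempty, h5]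
      push_cast
      simp
      left
      ring

/-- Compositions of `s` into `m + 1` parts, all positive except possibly the first. -/
def admissible (m s : ℕ) : Finset (Fin (m + 1) → ℕ) :=
  (Finset.piAntidiag Finset.univ s).filter fun d => ∀ k, k ≠ 0 → 1 ≤ d k

lemma mem_admissible {m s : ℕ} {d : Fin (m + 1) → ℕ} :
    d ∈ admissible m s ↔ ∑ k, d k = s ∧ ∀ k, k ≠ 0 → 1 ≤ d k := by
  simp [admissible]

lemma snoc_mem_admissible {m s x : ℕ} {d : Fin (m + 1) → ℕ} :
    (Fin.snoc d x : Fin (m + 2) → ℕ) ∈ admissible (m + 1) s ↔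
      1 ≤ x ∧ x ≤ s ∧ d ∈ admissible m (s - x) := by
  rw [mem_admissible, mem_admissible, Fin.sum_univ_castSucc, Fin.forall_fin_succ']
  simp only [Fin.snoc_castSucc, Fin.snoc_last, ne_eq, Fin.castSucc_eq_zero_iff,
    Fin.last_eq_zero_iff]
  grind

lemma sum_admissible_succ {M : Type*} [AddCommMonoid M] (m s : ℕ) (F : (Fin (m + 2) → ℕ) → M) :
    ∑ d ∈ admissible (m + 1) s, F d =
      ∑ t ∈ Finset.range s, ∑ d ∈ admissible m t, F (Fin.snoc d (s - t)) := by
  rw [Finset.sum_sigma']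
  symm
  refine Finset.sum_bij' (fun p _ => (Fin.snoc p.2 (s - p.1) : Fin (m + 2) → ℕ))
    (fun d _ => ⟨s - d (Fin.last _), Fin.init d⟩) ?_ ?_ ?_ ?_ ?_
  · rintro ⟨t, d⟩ h
    rw [Finset.mem_sigma, Finset.mem_range] at h
    have h1 : t < s := h.1
    rw [snoc_mem_admissible]
    refine ⟨by simp only; omega, by simp only; omega, ?_⟩
    rw [show s - (s - t) = t by omega]
    exact h.2
  · intro d h
    rw [← Fin.snoc_init_self d, snoc_mem_admissible] at h
    rw [Finset.mem_sigma, Finset.mem_range]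
    exact ⟨by simp only; omega, h.2.2⟩
  · rintro ⟨t, d⟩ h
    rw [Finset.mem_sigma, Finset.mem_range] at h
    have h1 : t < s := h.1
    simp only [Fin.snoc_last, Fin.init_snoc]
    rw [show s - (s - t) = t by omega]
  · intro d h
    rw [← Fin.snoc_init_self d, snoc_mem_admissible] at h
    simp only
    rw [show s - (s - d (Fin.last _)) = d (Fin.last _) by omega]
    exact Fin.snoc_init_self d
  · intro p _
    rfl

lemma multinomial_snoc {m t x : ℕ} {d : Fin (m + 1) → ℕ} (hd : ∑ k, d k = t) :
    Nat.multinomial Finset.univ (Fin.snoc d x : Fin (m + 2) → ℕ) =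
      (t + x).choose t * Nat.multinomial Finset.univ d := by
  rw [Fin.univ_castSuccEmb, Nat.multinomial_cons, Finset.sum_map]
  simp only [Fin.coe_castSuccEmb, Fin.snoc_castSucc, Fin.snoc_last, hd]
  congr 1
  · rw [add_comm x t, Nat.choose_symm_add]
  · simp [Nat.multinomial, Finset.sum_map, Finset.prod_map]

/-- The number of strict chains of `m + 1` sets ending in a given set of cardinality `s`. -/
def chainNumber (m s : ℕ) : ℕ :=
  ∑ d ∈ admissible m s, Nat.multinomial Finset.univ d

lemma chainNumber_zero (s : ℕ) : chainNumber 0 s = 1 := by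
  have : admissible 0 s = {fun _ => s} := by
    ext d
    rw [mem_admissible, Finset.mem_singleton]
    simp [funext_iff, Fin.forall_fin_one]
  rw [chainNumber, this, Finset.sum_singleton]
  simp

lemma chainNumber_succ (m s : ℕ) :
    chainNumber (m + 1) s = ∑ t ∈ Finset.range s, s.choose t * chainNumber m t := by
  rw [chainNumber, sum_admissible_succ]
  refine Finset.sum_congr rfl fun t ht => ?_
  rw [chainNumber, Finset.mul_sum]
  refine Finset.sum_congr rfl fun d hd => ?_
  rw [multinomial_snoc (mem_admissible.1 hd).1,
    Nat.add_sub_cancel' (Finset.mem_range.1 ht).le]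

/-- The strict chains of `m + 1` sets ending in `T`. -/
def chainsTo (m : ℕ) (T : Finset ℕ) : Finset (Fin (m + 1) → Finset ℕ) :=
  (Fintype.piFinset fun _ => T.powerset).filter
    fun f => (∀ j k, j < k → f j ⊂ f k) ∧ f (Fin.last m) = T

lemma mem_chainsTo {m : ℕ} {T : Finset ℕ} {f : Fin (m + 1) → Finset ℕ} :
    f ∈ chainsTo m T ↔ (∀ j k, j < k → f j ⊂ f k) ∧ f (Fin.last m) = T := by
  rw [chainsTo, Finset.mem_filter, Fintype.mem_piFinset, and_iff_right_iff_imp]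
  rintro ⟨h1, rfl⟩ j
  rw [Finset.mem_powerset]
  rcases (Fin.le_last j).eq_or_lt with rfl | h
  · rfl
  · exact (h1 _ _ h).subset

lemma card_chainsTo_succ (m : ℕ) (T : Finset ℕ) :
    (chainsTo (m + 1) T).card = ∑ S ∈ T.ssubsets, (chainsTo m S).card := by
  rw [← Finset.card_sigma]
  symm
  refine Finset.card_bij' (fun p _ => (Fin.snoc p.2 T : Fin (m + 2) → Finset ℕ))
    (fun f _ => ⟨f (Fin.last m).castSucc, Fin.init f⟩) ?_ ?_ ?_ ?_
  · rintro ⟨S, f⟩ h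
    rw [Finset.mem_sigma, Finset.mem_ssubsets, mem_chainsTo] at h
    obtain ⟨h1, h2, h3⟩ := h
    simp only at h1 h2 h3
    rw [mem_chainsTo]
    refine ⟨?_, Fin.snoc_last _ _⟩
    intro j k
    induction k using Fin.lastCases with
    | last =>
      induction j using Fin.lastCases with
      | last => simp
      | cast j =>
        intro _
        simp only [Fin.snoc_castSucc, Fin.snoc_last]
        rcases (Fin.le_last j).eq_or_lt with rfl | h
        · rwa [h3]
        · exact (h2 _ _ h).trans (h3 ▸ h1)
    | cast k =>
      induction j using Fin.lastCases with
      | last => exact fun h => absurd h (Fin.le_last _).not_gt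
      | cast j =>
        simp only [Fin.snoc_castSucc, Fin.castSucc_lt_castSucc_iff]
        exact h2 j k
  · intro f h
    rw [mem_chainsTo] at h
    rw [Finset.mem_sigma, Finset.mem_ssubsets, mem_chainsTo]
    refine ⟨?_, fun j k hjk => h.1 _ _ (Fin.castSucc_lt_castSucc_iff.2 hjk), rfl⟩
    rw [← h.2]
    exact h.1 _ _ (Fin.castSucc_lt_last _)
  · rintro ⟨S, f⟩ h
    rw [Finset.mem_sigma, mem_chainsTo] at h
    have hlast : f (Fin.last m) = S := h.2.2
    simp only [Fin.snoc_castSucc, Fin.init_snoc, hlast]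
  · intro f h
    rw [mem_chainsTo] at h
    rw [← h.2]
    exact Fin.snoc_init_self f

lemma sum_ssubsets_apply_card (T : Finset ℕ) (F : ℕ → ℕ) :
    ∑ S ∈ T.ssubsets, F S.card = ∑ t ∈ Finset.range T.card, T.card.choose t * F t := by
  have h := Finset.sum_powerset_apply_card F (x := T)
  rw [Finset.sum_range_succ, ← Finset.sum_erase_add _ _ (Finset.mem_powerset_self T)] at h
  simpa [Finset.ssubsets] using h

lemma card_chainsTo (m : ℕ) (T : Finset ℕ) : (chainsTo m T).card = chainNumber m T.card := by
  induction m generalizing T with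
  | zero =>
    rw [chainNumber_zero, Finset.card_eq_one]
    refine ⟨fun _ => T, ?_⟩
    ext f
    rw [mem_chainsTo, Finset.mem_singleton]
    simp [funext_iff, Fin.forall_fin_one]
  | succ m ih =>
    rw [card_chainsTo_succ, chainNumber_succ, ← sum_ssubsets_apply_card]
    exact Finset.sum_congr rfl fun S _ => ih S

lemma mem_Pn_of_subset {n : ℕ} (hn : 1 ≤ n) {S T : Finset ℕ} (hST : S ⊆ T) (hT : T ∈ Pn n) :
    S ∈ Pn n := by
  rw [mem_Pn_iff hn] at hT ⊢
  refine ⟨hST.trans hT.1, fun m h1 h2 => ?_⟩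
  have := hT.2 m h1 h2
  have := Finset.card_le_card (Finset.filter_subset_filter (· ≤ m) hST)
  omega

lemma ncard_chains_Pn {n : ℕ} (hn : 1 ≤ n) (m : ℕ) :
    Set.ncard {f : Fin (m + 1) → Finset ℕ |
        (∀ j, f j ∈ Pn n) ∧ ∀ j k : Fin (m + 1), j < k → f j ⊂ f k} =
      ∑ T ∈ Pn n, chainNumber m T.card := by
  have : {f : Fin (m + 1) → Finset ℕ |
      (∀ j, f j ∈ Pn n) ∧ ∀ j k : Fin (m + 1), j < k → f j ⊂ f k} =
      ((Pn n).biUnion (chainsTo m) : Set (Fin (m + 1) → Finset ℕ)) := by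
    ext f
    simp only [Set.mem_ofPred_eq, Finset.mem_coe, Finset.mem_biUnion, mem_chainsTo]
    constructor
    · exact fun h => ⟨_, h.1 _, h.2, rfl⟩
    · rintro ⟨T, hT, h, rfl⟩
      refine ⟨fun j => mem_Pn_of_subset hn ?_ hT, h⟩
      rcases (Fin.le_last j).eq_or_lt with rfl | hj
      · rfl
      · exact (h _ _ hj).subset
  rw [this, Set.ncard_coe_finset, Finset.card_biUnion]
  · exact Finset.sum_congr rfl fun T _ => card_chainsTo m T
  · intro S _ T _ hST
    rw [Function.onFun, Finset.disjoint_left]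
    intro f hS hT
    exact hST ((mem_chainsTo.1 hS).2.symm.trans (mem_chainsTo.1 hT).2)

lemma card_filter_Pn_card {n k : ℕ} (hn : 1 ≤ n) (hk : 2 * k < n) :
    (n * ((Pn n).filter fun S => S.card = k).card : ℚ) = (n - 2 * k) * n.choose k := by
  classical
  rw [← mul_card_ballot n k hn (by omega)]
  congr 3
  ext S
  simp only [Finset.mem_filter, mem_Pn_iff hn, Finset.mem_powersetCard]
  tauto

lemma sum_Pn_apply_card {n : ℕ} (hn : 1 ≤ n) (F : ℕ → ℕ) :
    ((∑ T ∈ Pn n, F T.card : ℕ) : ℚ) =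
      ∑ t ∈ Finset.range n, if 2 * t < n then (n.choose t * F t * (n - 2 * t) / n : ℚ) else 0 := by
  have hlt : ∀ S ∈ Pn n, 2 * S.card < n := fun S hS => by
    rw [mem_Pn_iff hn] at hS
    exact hS.2.two_mul_card_lt hn hS.1
  rw [← Finset.sum_fiberwise_of_maps_to (g := Finset.card) (t := Finset.range n)
    (fun S hS => Finset.mem_range.2 (by have := hlt S hS; omega)), Nat.cast_sum]
  refine Finset.sum_congr rfl fun t _ => ?_
  rw [Finset.sum_congr rfl fun S hS => by rw [(Finset.mem_filter.1 hS).2], Finset.sum_const]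
  split_ifs with ht
  · have := card_filter_Pn_card hn ht
    have hn0 : (n : ℚ) ≠ 0 := by positivity
    rw [eq_div_iff hn0]
    push_cast [nsmul_eq_mul]
    linear_combination (F t : ℚ) * this
  · rw [Finset.filter_false_of_mem fun S hS (h : S.card = t) => ht (h ▸ hlt S hS)]
    simp

/-- Theorem 3.5: the number of strict chains `S_1 ⊊ S_2 ⊊ … ⊊ S_i` in `P_n` equals
`Σ multinomial(n; d_1, …, d_{i+1})·(2d_{i+1} − n)/n`, the sum ranging over all
`(d_1, …, d_{i+1})` with `Σ d_k = n`, `d_1 ≥ 0`, `d_k ≥ 1` for `2 ≤ k ≤ i`, and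
`d_{i+1} ≥ n − ⌊(n−1)/2⌋`. -/
theorem Pn_chain_count (n i : ℕ) (hn : 3 ≤ n) (hi : 1 ≤ i) :
    (Set.ncard {f : Fin i → Finset ℕ |
        (∀ j, f j ∈ Pn n) ∧ ∀ j k : Fin i, j < k → f j ⊂ f k} : ℚ) =
      ∑ d ∈ (Fintype.piFinset fun _ : Fin (i + 1) => Finset.range (n + 1)).filter
          (fun d => (∑ k, d k) = n ∧
            (∀ k : Fin (i + 1), 1 ≤ (k : ℕ) → (k : ℕ) ≤ i - 1 → 1 ≤ d k) ∧
            n - (n - 1) / 2 ≤ d (Fin.last i)),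
        (Nat.multinomial Finset.univ d : ℚ) *
          (2 * (d (Fin.last i) : ℚ) - (n : ℚ)) / (n : ℚ) := by
  obtain ⟨m, rfl⟩ : ∃ m, i = m + 1 := ⟨i - 1, by omega⟩
  have hindex : (Fintype.piFinset fun _ : Fin (m + 1 + 1) => Finset.range (n + 1)).filter
      (fun d => (∑ k, d k) = n ∧
        (∀ k : Fin (m + 1 + 1), 1 ≤ (k : ℕ) → (k : ℕ) ≤ m + 1 - 1 → 1 ≤ d k) ∧
        n - (n - 1) / 2 ≤ d (Fin.last (m + 1))) =
      (admissible (m + 1) n).filter fun d => n - (n - 1) / 2 ≤ d (Fin.last (m + 1)) := by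
    ext d
    simp only [Finset.mem_filter, mem_admissible, Fintype.mem_piFinset, Finset.mem_range]
    constructor
    · rintro ⟨-, h1, h2, h3⟩
      refine ⟨⟨h1, fun k hk => ?_⟩, h3⟩
      have hk0 : (k : ℕ) ≠ 0 := fun h => hk (Fin.ext h)
      rcases (Fin.le_last k).eq_or_lt with rfl | h
      · omega
      · rw [Fin.lt_def, Fin.val_last] at h
        exact h2 k (by omega) (by omega)
    · rintro ⟨⟨h1, h2⟩, h3⟩
      refine ⟨fun k => ?_, h1, fun k hk _ => h2 k ?_, h3⟩
      · have := Finset.single_le_sum (f := d) (fun _ _ => Nat.zero_le _) (Finset.mem_univ k)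
        omega
      · rintro rfl
        simp at hk
  rw [ncard_chains_Pn (by omega), sum_Pn_apply_card (by omega), hindex, Finset.sum_filter,
    sum_admissible_succ]
  refine Finset.sum_congr rfl fun t ht => ?_
  rw [Finset.mem_range] at ht
  simp only [Fin.snoc_last]
  split_ifs with h1 h2 h2
  · rw [chainNumber, Nat.cast_sum, Finset.mul_sum, Finset.sum_mul, Finset.sum_div]
    refine Finset.sum_congr rfl fun d hd => ?_
    rw [multinomial_snoc (mem_admissible.1 hd).1, Nat.add_sub_cancel' ht.le,
      Nat.cast_sub ht.le]
    push_cast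
    ring
  · omega
  · omega
  · simp
end

section
/- Let n ≥ 3, let K be a field, and consider the polynomial ring K[x_S : S ∈ P_n] with one variable for each element of P_n. Let J be the ideal generated by all products x_S · x_T where S, T ∈ P_n are incomparable under inclusion, together with all squares x_S^2 for S ∈ P_n, and let B = K[x_S : S ∈ P_n]/J, a graded algebra. Then for every integer i with 1 ≤ i ≤ ⌊(n−1)/2⌋ + 1, the K-dimension of the degree-i homogeneous component of B equals Σ multinomial(n; d_1, ..., d_{i+1}) · (2·d_{i+1} − n)/n, where the sum is over all (i+1)-tuples (d_1, ..., d_{i+1}) of integers with d_1 + ... + d_{i+1} = n, d_1 ≥ 0, d_k ≥ 1 for 2 ≤ k ≤ i, and d_{i+1} ≥ n − ⌊(n−1)/2⌋. -/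
open Finset Polynomial

/-- The ideal of `K[σ]` generated by all squares of variables and by the products of pairs of
variables related by `R` is the span of the corresponding monomials. -/
lemma span_pairs_union_squares_eq_span_monomial {σ K : Type*} [CommRing K] (R : σ → σ → Prop) :
    Ideal.span ({p : MvPolynomial σ K |
        ∃ s t : σ, R s t ∧ p = MvPolynomial.X s * MvPolynomial.X t} ∪
      {p : MvPolynomial σ K | ∃ s : σ, p = MvPolynomial.X s ^ 2}) =
    Ideal.span ((fun m => MvPolynomial.monomial m (1 : K)) ''
      {m : σ →₀ ℕ | ∃ s t : σ, (R s t ∨ s = t) ∧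
        m = Finsupp.single s 1 + Finsupp.single t 1}) := by
  congr 1
  ext p
  simp only [Set.mem_union, Set.mem_ofPred_eq, Set.mem_image]
  constructor
  · rintro (⟨s, t, h, rfl⟩ | ⟨s, rfl⟩)
    · exact ⟨_, ⟨s, t, Or.inl h, rfl⟩, by simp [MvPolynomial.X, MvPolynomial.monomial_mul]⟩
    · exact ⟨_, ⟨s, s, Or.inr rfl, rfl⟩, by simp [MvPolynomial.X, MvPolynomial.monomial_mul, sq]⟩
  · rintro ⟨_, ⟨s, t, h | rfl, rfl⟩, rfl⟩
    · exact Or.inl ⟨s, t, h, by simp [MvPolynomial.X, MvPolynomial.monomial_mul]⟩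
    · exact Or.inr ⟨s, by simp [MvPolynomial.X, MvPolynomial.monomial_mul, sq]⟩

/-- A monomial is divisible by none of the quadratic monomials attached to `R` exactly when it is
squarefree with no two distinct variables of its support related by `R`. -/
lemma not_exists_pair_le_iff {σ : Type*} (R : σ → σ → Prop) (m : σ →₀ ℕ) :
    (¬ ∃ g ∈ {g : σ →₀ ℕ | ∃ s t : σ, (R s t ∨ s = t) ∧
        g = Finsupp.single s 1 + Finsupp.single t 1}, g ≤ m) ↔
      (∀ s, m s ≤ 1) ∧ ∀ s ∈ m.support, ∀ t ∈ m.support, s ≠ t → ¬ R s t := by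
  classical
  constructor
  · intro h
    refine ⟨fun s => ?_, fun s hs t ht hst hR => ?_⟩
    · by_contra hs
      refine h ⟨_, ⟨s, s, Or.inr rfl, rfl⟩, fun u => ?_⟩
      by_cases hu : s = u
      · subst hu; simp; omega
      · simp [hu]
    · refine h ⟨_, ⟨s, t, Or.inl hR, rfl⟩, fun u => ?_⟩
      have h1 : 1 ≤ m s := Nat.one_le_iff_ne_zero.2 (Finsupp.mem_support_iff.1 hs)
      have h2 : 1 ≤ m t := Nat.one_le_iff_ne_zero.2 (Finsupp.mem_support_iff.1 ht)
      by_cases hu : s = u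
      · subst hu; simpa [Finsupp.single_apply, hst.symm] using h1
      · by_cases hu' : t = u
        · subst hu'; simpa [Finsupp.single_apply, hst] using h2
        · simp [hu, hu']
  · rintro ⟨h1, h2⟩ ⟨_, ⟨s, t, hR, rfl⟩, hle⟩
    by_cases hst : s = t
    · subst hst
      have := hle s
      have := h1 s
      simp at *
      omega
    · have hs := hle s
      have ht := hle t
      simp only [Finsupp.add_apply, Finsupp.single_apply, if_true, if_neg hst,
        if_neg (Ne.symm hst)] at hs ht
      refine h2 s (Finsupp.mem_support_iff.2 (by omega)) t (Finsupp.mem_support_iff.2 (by omega))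
        hst (hR.resolve_right hst)

/-- Hilbert function of the quotient of a polynomial ring by all squares of variables and the
products of `R`-related pairs: the degree `i` component has dimension the number of `i`-element
sets of pairwise unrelated variables. -/
theorem finrank_map_homogeneousSubmodule_eq_card {σ K : Type*} [Fintype σ] [Field K]
    (R : σ → σ → Prop) (i : ℕ) :
    Module.finrank K
      (Submodule.map
        (Ideal.Quotient.mkₐ K
          (Ideal.span ({p : MvPolynomial σ K |
              ∃ s t : σ, R s t ∧ p = MvPolynomial.X s * MvPolynomial.X t} ∪
            {p : MvPolynomial σ K | ∃ s : σ, p = MvPolynomial.X s ^ 2}))).toLinearMap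
        (MvPolynomial.homogeneousSubmodule σ K i)) =
      Nat.card {C : Finset σ // C.card = i ∧ ∀ s ∈ C, ∀ t ∈ C, s ≠ t → ¬ R s t} := by
  classical
  rw [span_pairs_union_squares_eq_span_monomial R]
  set G := {m : σ →₀ ℕ | ∃ s t : σ, (R s t ∨ s = t) ∧
        m = Finsupp.single s 1 + Finsupp.single t 1}
  set J := Ideal.span ((fun m => MvPolynomial.monomial m (1 : K)) '' G) with hJ
  let N := {C : Finset σ // C.card = i ∧ ∀ s ∈ C, ∀ t ∈ C, s ≠ t → ¬ R s t}
  let e : Finset σ → (σ →₀ ℕ) := fun C => Finsupp.indicator C (fun _ _ => 1)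
  have he : ∀ C s, e C s = if s ∈ C then 1 else 0 := fun C s => by
    simp [e, Finsupp.indicator_apply]
  have hsupp : ∀ C, (e C).support = C := fun C => by ext s; simp [he]
  have hinj : Function.Injective e := fun C D h => by rw [← hsupp C, h, hsupp]
  have hdeg : ∀ C, (e C).degree = C.card := fun C => by
    rw [Finsupp.degree_apply, hsupp]; simp [he]
  let b : N → MvPolynomial σ K ⧸ J := fun C =>
    Ideal.Quotient.mkₐ K J (MvPolynomial.monomial (e C.1) 1)
  have hlin : LinearIndependent K b := by
    rw [Fintype.linearIndependent_iff]
    intro g hg C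
    by_contra hC
    have h0 : Ideal.Quotient.mkₐ K J
        (∑ D : N, MvPolynomial.monomial (e D.1) (g D)) = 0 := by
      rw [map_sum, ← hg]
      refine Finset.sum_congr rfl fun D _ => ?_
      rw [← map_smul, MvPolynomial.smul_monomial, smul_eq_mul, mul_one]
    rw [Ideal.Quotient.mkₐ_eq_mk, Ideal.Quotient.eq_zero_iff_mem, hJ,
      MvPolynomial.mem_ideal_span_monomial_image] at h0
    have hmem : e C.1 ∈ (∑ D : N, MvPolynomial.monomial (e D.1) (g D)).support := by
      rw [MvPolynomial.mem_support_iff, MvPolynomial.coeff_sum]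
      rw [Finset.sum_eq_single C (fun D _ hD => ?_) (by simp), MvPolynomial.coeff_monomial,
        if_pos rfl]
      · exact hC
      · rw [MvPolynomial.coeff_monomial, if_neg fun h => hD (Subtype.ext (hinj h))]
    refine (not_exists_pair_le_iff R (e C.1)).2 ⟨fun s => ?_, ?_⟩ (h0 _ hmem)
    · rw [he]; split_ifs <;> omega
    · rw [hsupp]; exact C.2.2
  have hspan : Submodule.map (Ideal.Quotient.mkₐ K J).toLinearMap
      (MvPolynomial.homogeneousSubmodule σ K i) = Submodule.span K (Set.range b) := by
    apply le_antisymm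
    · rintro _ ⟨p, hp, rfl⟩
      rw [p.as_sum, map_sum]
      refine Submodule.sum_mem _ fun m hm => ?_
      by_cases hdiv : ∃ g ∈ G, g ≤ m
      · convert Submodule.zero_mem _
        rw [AlgHom.toLinearMap_apply, Ideal.Quotient.mkₐ_eq_mk, Ideal.Quotient.eq_zero_iff_mem, hJ,
          MvPolynomial.mem_ideal_span_monomial_image]
        intro x hx
        rwa [Finset.mem_singleton.1 (MvPolynomial.support_monomial_subset hx)]
      · obtain ⟨h1, h2⟩ := (not_exists_pair_le_iff R m).1 hdiv
        have hm' : m = e m.support := by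
          ext s
          rw [he]
          have := h1 s
          split_ifs with hs
          · have := Finsupp.mem_support_iff.1 hs; omega
          · exact Finsupp.notMem_support_iff.1 hs
        have hcard : m.support.card = i := by
          rw [← hdeg, ← hm']
          by_contra hne
          exact MvPolynomial.mem_support_iff.1 hm
            (MvPolynomial.IsHomogeneous.coeff_eq_zero
              ((MvPolynomial.mem_homogeneousSubmodule i p).1 hp) hne)
        have : (Ideal.Quotient.mkₐ K J).toLinearMap
            (MvPolynomial.monomial m (MvPolynomial.coeff m p)) =
            MvPolynomial.coeff m p • b ⟨m.support, hcard, h2⟩ := by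
          simp only [b]
          rw [← map_smul, MvPolynomial.smul_monomial, smul_eq_mul, mul_one, ← hm']
          rfl
        rw [this]
        exact Submodule.smul_mem _ _ (Submodule.subset_span ⟨_, rfl⟩)
    · rw [Submodule.span_le]
      rintro _ ⟨C, rfl⟩
      exact ⟨_, MvPolynomial.isHomogeneous_monomial _ ((hdeg C.1).trans C.2.1), rfl⟩
  rw [hspan, finrank_span_eq_card hlin, Nat.card_eq_fintype_card]

open scoped Classical in
/-- Strict ballot subsets of `[n]`: those `S` with `2·|S ∩ [j]| < j` for all `j ∈ [n]`. -/
noncomputable def ballotSets (n : ℕ) : Finset (Finset ℕ) :=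
  (Finset.Icc 1 n).powerset.filter fun S : Finset ℕ =>
    ∀ j ∈ Finset.Icc 1 n, 2 * (S ∩ Finset.Icc 1 j).card < j

lemma mem_ballotSets {n : ℕ} {S : Finset ℕ} : S ∈ ballotSets n ↔
    S ⊆ Finset.Icc 1 n ∧ ∀ j ∈ Finset.Icc 1 n, 2 * (S ∩ Finset.Icc 1 j).card < j := by
  simp [ballotSets]

lemma ballotSets_of_subset {n : ℕ} {S T : Finset ℕ} (hS : S ∈ ballotSets n) (hTS : T ⊆ S) :
    T ∈ ballotSets n := by
  rw [mem_ballotSets] at *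
  refine ⟨hTS.trans hS.1, fun j hj => lt_of_le_of_lt ?_ (hS.2 j hj)⟩
  gcongr

lemma two_mul_card_lt_of_mem_ballotSets {n : ℕ} (hn : 1 ≤ n) {S : Finset ℕ}
    (hS : S ∈ ballotSets n) : 2 * S.card < n := by
  rw [mem_ballotSets] at hS
  simpa [Finset.inter_eq_left.2 hS.1] using hS.2 n (by simp [hn])

lemma inter_Icc_succ_of_subset {n : ℕ} {S : Finset ℕ} (hS : S ⊆ Finset.Icc 1 n) :
    S ∩ Finset.Icc 1 (n + 1) = S :=
  Finset.inter_eq_left.2 (hS.trans (Finset.Icc_subset_Icc_right n.le_succ))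

lemma mem_ballotSets_succ_of_notMem {n : ℕ} {S : Finset ℕ} (h : n + 1 ∉ S) :
    S ∈ ballotSets (n + 1) ↔ S ∈ ballotSets n ∧ 2 * S.card < n + 1 := by
  constructor
  · intro hS
    refine ⟨?_, two_mul_card_lt_of_mem_ballotSets (by omega) hS⟩
    rw [mem_ballotSets] at *
    refine ⟨fun x hx => ?_, fun j hj => hS.2 j ?_⟩
    · have := hS.1 hx
      have : x ≠ n + 1 := fun hh => h (hh ▸ hx)
      simp at *; omega
    · simp at *; omega
  · rintro ⟨hS, hc⟩
    rw [mem_ballotSets] at *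
    refine ⟨hS.1.trans (Finset.Icc_subset_Icc_right n.le_succ), fun j hj => ?_⟩
    rcases (Finset.mem_Icc.1 hj).2.lt_or_eq with hlt | rfl
    · exact hS.2 j (by simp at *; omega)
    · rwa [inter_Icc_succ_of_subset hS.1]

lemma insert_mem_ballotSets_succ {n : ℕ} {S : Finset ℕ} (h : n + 1 ∉ S) :
    insert (n + 1) S ∈ ballotSets (n + 1) ↔ S ∈ ballotSets n ∧ 2 * (S.card + 1) < n + 1 := by
  constructor
  · intro hS
    have hc := two_mul_card_lt_of_mem_ballotSets (by omega) hS
    rw [Finset.card_insert_of_notMem h] at hc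
    exact ⟨((mem_ballotSets_succ_of_notMem h).1
      (ballotSets_of_subset hS (Finset.subset_insert _ _))).1, hc⟩
  · rintro ⟨hS, hc⟩
    rw [mem_ballotSets] at *
    refine ⟨Finset.insert_subset (by simp) (hS.1.trans (Finset.Icc_subset_Icc_right n.le_succ)),
      fun j hj => ?_⟩
    rcases (Finset.mem_Icc.1 hj).2.lt_or_eq with hlt | rfl
    · rw [Finset.insert_inter_of_notMem (by simp; omega)]
      exact hS.2 j (by simp at *; omega)
    · rw [Finset.insert_inter_of_mem (by simp), inter_Icc_succ_of_subset hS.1,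
        Finset.card_insert_of_notMem h]
      exact hc

lemma notMem_of_mem_ballotSets {n : ℕ} {S : Finset ℕ} (hS : S ∈ ballotSets n) : n + 1 ∉ S :=
  fun h => by simpa using (mem_ballotSets.1 hS).1 h

/-- The number of `k`-element strict ballot subsets of `[n]`. -/
noncomputable def ballotCount (n k : ℕ) : ℕ := ((ballotSets n).filter fun S => S.card = k).card

lemma ballotCount_zero_right (n : ℕ) : ballotCount n 0 = 1 := by
  rw [ballotCount, Finset.card_eq_one]
  refine ⟨∅, ?_⟩
  ext S
  simp only [Finset.mem_filter, Finset.card_eq_zero, Finset.mem_singleton, and_iff_right_iff_imp]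
  rintro rfl
  rw [mem_ballotSets]
  simp
  omega

lemma ballotCount_eq_zero {n k : ℕ} (hn : 1 ≤ n) (h : n ≤ 2 * k) : ballotCount n k = 0 := by
  rw [ballotCount, Finset.card_eq_zero, Finset.filter_eq_empty_iff]
  intro S hS hk
  have := two_mul_card_lt_of_mem_ballotSets hn hS
  omega

lemma ballotCount_succ_succ {n k : ℕ} (h : 2 * (k + 1) < n + 1) :
    ballotCount (n + 1) (k + 1) = ballotCount n (k + 1) + ballotCount n k := by
  have hsplit : (ballotSets (n + 1)).filter (fun S => S.card = k + 1) =
      (ballotSets n).filter (fun S => S.card = k + 1) ∪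
        ((ballotSets n).filter (fun S => S.card = k)).image (insert (n + 1)) := by
    ext S
    simp only [Finset.mem_filter, Finset.mem_union, Finset.mem_image]
    constructor
    · rintro ⟨hS, hc⟩
      by_cases hm : n + 1 ∈ S
      · right
        refine ⟨S.erase (n + 1), ⟨?_, ?_⟩, Finset.insert_erase hm⟩
        · rw [← Finset.insert_erase hm] at hS
          exact ((insert_mem_ballotSets_succ (by simp)).1 hS).1
        · rw [Finset.card_erase_of_mem hm, hc]; rfl
      · exact Or.inl ⟨((mem_ballotSets_succ_of_notMem hm).1 hS).1, hc⟩
    · rintro (⟨hS, hc⟩ | ⟨T, ⟨hT, hc⟩, rfl⟩)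
      · exact ⟨(mem_ballotSets_succ_of_notMem (notMem_of_mem_ballotSets hS)).2
          ⟨hS, by omega⟩, hc⟩
      · have hm := notMem_of_mem_ballotSets hT
        exact ⟨(insert_mem_ballotSets_succ hm).2 ⟨hT, by omega⟩,
          by rw [Finset.card_insert_of_notMem hm, hc]⟩
  rw [ballotCount, hsplit, Finset.card_union_of_disjoint, Finset.card_image_of_injOn]
  · rfl
  · intro S hS T hT hST
    have hS' := notMem_of_mem_ballotSets (Finset.mem_filter.1 hS).1
    have hT' := notMem_of_mem_ballotSets (Finset.mem_filter.1 hT).1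
    rw [← Finset.erase_insert hS', ← Finset.erase_insert hT']
    exact congrArg (fun U => Finset.erase U (n + 1)) hST
  · rw [Finset.disjoint_left]
    intro S hS hS'
    obtain ⟨T, -, rfl⟩ := Finset.mem_image.1 hS'
    exact notMem_of_mem_ballotSets (Finset.mem_filter.1 hS).1 (Finset.mem_insert_self _ _)

lemma ballotCount_add_choose (n k : ℕ) (h : 2 * (k + 1) ≤ n + 1) :
    ballotCount (n + 1) (k + 1) + n.choose k = n.choose (k + 1) := by
  induction n generalizing k with
  | zero => omega
  | succ n ih =>
    rcases h.lt_or_eq with hlt | heq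
    · rw [ballotCount_succ_succ hlt, Nat.choose_succ_succ' n k]
      have h1 := ih k (by omega)
      cases k with
      | zero =>
        rw [ballotCount_zero_right]
        simp at *; omega
      | succ k =>
        rw [Nat.choose_succ_succ' n k]
        have h2 := ih k (by omega)
        omega
    · rw [ballotCount_eq_zero (by omega) heq.ge, zero_add]
      exact Nat.choose_symm_of_eq_add (by omega)

/-- The ballot theorem for strict ballot subsets. -/
theorem ballotCount_eq {n k : ℕ} (hn : 1 ≤ n) (hk : 2 * k ≤ n) :
    (ballotCount n k : ℚ) = n.choose k * (n - 2 * k) / n := by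
  obtain ⟨n, rfl⟩ := Nat.exists_eq_add_of_le' hn
  have hn0 : ((n + 1 : ℕ) : ℚ) ≠ 0 := by positivity
  rw [eq_div_iff hn0]
  cases k with
  | zero => simp [ballotCount_zero_right]
  | succ k =>
    have h1 := ballotCount_add_choose n k hk
    have h2 := Nat.choose_succ_right_eq n k
    have h3 : (n - k : ℕ) = (n : ℚ) - k := by rw [Nat.cast_sub (by omega)]
    rw [Nat.choose_succ_succ]
    apply_fun (Nat.cast : ℕ → ℚ) at h1 h2
    push_cast at h1 h2 ⊢
    rw [h3] at h2
    linear_combination (n + 1 : ℚ) * h1 + 2 * h2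

lemma two_mul_card_inter_CP_lt {n : ℕ} {σ : ℕ → ℕ} (hσ : IsPermOn n σ) {j : ℕ} (hj : 1 ≤ j) :
    2 * (CP n σ ∩ Finset.Icc 1 j).card < j := by
  set I := (Finset.Icc 2 (n - 1)).filter
    (fun i => (σ (i - 1) < σ i ∧ σ (i + 1) < σ i) ∧ σ i ≤ j) with hI
  have hmem : ∀ i ∈ I, (2 ≤ i ∧ i ≤ n - 1) ∧ (σ (i - 1) < σ i ∧ σ (i + 1) < σ i) ∧ σ i ≤ j := by
    intro i hi
    simpa [hI] using hi
  have hA : CP n σ ∩ Finset.Icc 1 j ⊆ I.image σ := by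
    intro x hx
    simp only [CP, Finset.mem_inter, Finset.mem_image, Finset.mem_filter, Finset.mem_Icc, hI] at *
    obtain ⟨⟨i, hi, rfl⟩, h1, h2⟩ := hx
    exact ⟨i, ⟨hi.1, hi.2, h2⟩, rfl⟩
  have hcard := (Finset.card_le_card hA).trans Finset.card_image_le
  rcases I.eq_empty_or_nonempty with h0 | hne
  · rw [h0, Finset.card_empty] at hcard
    omega
  set m := I.min' hne with hm
  have hmI : m ∈ I := Finset.min'_mem _ _
  have hmin : ∀ i ∈ I, m ≤ i := fun i hi => Finset.min'_le _ _ hi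
  have hdisj : Disjoint I (I.image (· + 1)) := by
    rw [Finset.disjoint_left]
    intro i hi hi'
    obtain ⟨k, hk, rfl⟩ := Finset.mem_image.1 hi'
    have h1 := (hmem _ hi).2.1.1
    have h2 := (hmem _ hk).2.1.2
    simp at h1 h2
    omega
  have hnot : m - 1 ∉ I ∪ I.image (· + 1) := by
    have := hmem m hmI
    simp only [Finset.mem_union, Finset.mem_image, not_or, not_exists, not_and]
    refine ⟨fun h => ?_, fun k hk h => ?_⟩
    · have := hmin _ h; omega
    · have := hmin _ hk; omega
  have hT : (insert (m - 1) (I ∪ I.image (· + 1))).card = 2 * I.card + 1 := by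
    rw [Finset.card_insert_of_notMem hnot, Finset.card_union_of_disjoint hdisj,
      Finset.card_image_of_injective _ (add_left_injective 1)]
    ring
  have hTn : ∀ x ∈ insert (m - 1) (I ∪ I.image (· + 1)), (1 ≤ x ∧ x ≤ n) ∧ σ x ≤ j := by
    intro x hx
    simp only [Finset.mem_insert, Finset.mem_union, Finset.mem_image] at hx
    rcases hx with rfl | hx | ⟨k, hk, rfl⟩
    · have := hmem m hmI; omega
    · have := hmem x hx; omega
    · have := hmem k hk; omega
  have hle : (insert (m - 1) (I ∪ I.image (· + 1))).card ≤ (Finset.Icc 1 j).card := by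
    refine Finset.card_le_card_of_injOn σ (fun x hx => ?_) (fun x hx y hy hxy => ?_)
    · have h1 := hTn x hx
      have h2 := hσ.mapsTo (Set.mem_Icc.2 h1.1)
      simp only [Finset.coe_Icc, Set.mem_Icc] at *
      omega
    · exact hσ.injOn (Set.mem_Icc.2 (hTn x hx).1) (Set.mem_Icc.2 (hTn y hy).1) hxy
  rw [hT, Nat.card_Icc] at hle
  omega

/-- Every strict ballot subset is the circular peak set of some permutation: interleave the
members of `S` with the smallest non-members and list the remaining non-members increasingly. -/
lemma exists_isPermOn_CP_eq {n : ℕ} (hn : 1 ≤ n) {S : Finset ℕ} (hS : S ∈ ballotSets n) :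
    ∃ σ : ℕ → ℕ, IsPermOn n σ ∧ CP n σ = S := by
  classical
  have hcard := two_mul_card_lt_of_mem_ballotSets hn hS
  obtain ⟨hSn, hbal⟩ := mem_ballotSets.1 hS
  have hS0 : 0 ∉ S := fun h => by simpa using hSn h
  have hinf : (Set.ofPred fun x => x ∉ S).Infinite := by
    have := S.finite_toSet.infinite_compl
    exact this
  set t := Nat.nth (fun x => x ∉ S) with ht
  set s := Nat.nth (fun x => x ∈ S) with hs
  set k := S.card with hk
  have htmono : StrictMono t := Nat.nth_strictMono hinf
  have htS : ∀ i, t i ∉ S := fun i => Nat.nth_mem_of_infinite hinf i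
  have ht0 : t 0 = 0 := by
    simp [ht, Nat.nth_zero_of_zero (p := fun x => x ∉ S) hS0]
  have hfin : ∀ i, i < k → ∀ hf : (Set.ofPred fun x => x ∈ S).Finite, i < hf.toFinset.card := by
    intro i hi hf
    have : hf.toFinset = S := by ext x; simp
    rwa [this]
  have hsS : ∀ i < k, s i ∈ S := fun i hi => Nat.nth_mem i (hfin i hi)
  have hsinj : ∀ i < k, ∀ j < k, s i = s j → i = j := by
    intro i hi j hj h
    have h1 := Nat.count_nth (hfin i hi)
    have h2 := Nat.count_nth (hfin j hj)
    rw [← h1, ← h2]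
    exact congrArg _ h
  have hssurj : ∀ x ∈ S, ∃ i < k, s i = x := by
    intro x hx
    obtain ⟨i, hi, h⟩ := Nat.exists_lt_card_nth_eq (p := fun x => x ∈ S) hx
    refine ⟨i, ?_, h⟩
    have := hi S.finite_toSet
    have h2 : (Set.Finite.toFinset (s := Set.ofPred fun x => x ∈ S) S.finite_toSet) = S := by
      ext x; simp
    rwa [h2] at this
  have hcount : ∀ a, Nat.count (fun x => x ∉ S) a + Nat.count (fun x => x ∈ S) a = a := by
    intro a
    induction a with
    | zero => simp
    | succ a ih => rw [Nat.count_succ, Nat.count_succ]; split_ifs <;> omega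
  have htn : ∀ i, i + k ≤ n → t i ≤ n := by
    intro i hi
    have h1 := hcount (n + 1)
    have h2 : Nat.count (fun x => x ∈ S) (n + 1) ≤ k := by
      rw [Nat.count_eq_card_filter_range]
      exact Finset.card_le_card fun x hx => (Finset.mem_filter.1 hx).2
    have : t i < n + 1 := Nat.nth_lt_of_lt_count (by omega)
    omega
  have hst : ∀ i < k, t (i + 2) < s i := by
    intro i hi
    apply Nat.nth_lt_of_lt_count
    have h1 := hcount (s i)
    have h2 : Nat.count (fun x => x ∈ S) (s i) = i := Nat.count_nth (hfin i hi)
    have h3 := hbal (s i) (hSn (hsS i hi))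
    have h4 : S ∩ Finset.Icc 1 (s i) = insert (s i) ((Finset.range (s i)).filter (· ∈ S)) := by
      ext x
      have := hsS i hi
      by_cases hx : x = s i
      · subst hx
        have := hSn this
        simp at this
        simp [hsS i hi]; omega
      · have : x ∈ S → 1 ≤ x := fun h => (Finset.mem_Icc.1 (hSn h)).1
        simp only [Finset.mem_inter, Finset.mem_Icc, Finset.mem_insert, hx, Finset.mem_filter,
          Finset.mem_range, false_or]
        constructor
        · rintro ⟨h, h'⟩; exact ⟨by omega, h⟩
        · rintro ⟨h, h'⟩; exact ⟨h', this h', by omega⟩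
    rw [h4, Finset.card_insert_of_notMem (by simp), ← Nat.count_eq_card_filter_range, h2] at h3
    omega
  let σ : ℕ → ℕ := fun p =>
    if p ≤ 2 * k then (if p % 2 = 0 then s (p / 2 - 1) else t ((p + 1) / 2)) else t (p - k)
  have hσeven : ∀ i < k, σ (2 * i + 2) = s i := by
    intro i hi
    simp only [σ]
    rw [if_pos (by omega), if_pos (by omega)]
    congr 1; omega
  have hσodd : ∀ i ≤ k, σ (2 * i + 1) = t (i + 1) := by
    intro i hi
    simp only [σ]
    split_ifs
    · omega
    · congr 1; omega
    · congr 1; omega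
  have hσbig : ∀ p, 2 * k < p → σ p = t (p - k) := by
    intro p hp
    simp only [σ]
    rw [if_neg (by omega)]
  have hcases : ∀ p, 1 ≤ p →
      (∃ i < k, p = 2 * i + 2) ∨ (∃ i < k, p = 2 * i + 1) ∨ 2 * k < p := by
    intro p hp
    by_cases h : 2 * k < p
    · exact Or.inr (Or.inr h)
    · rcases Nat.even_or_odd' p with ⟨c, rfl | rfl⟩
      · exact Or.inl ⟨c - 1, by omega, by omega⟩
      · exact Or.inr (Or.inl ⟨c, by omega, rfl⟩)
  have htpos : ∀ i, 1 ≤ i → 1 ≤ t i := by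
    intro i hi
    have := htmono (show 0 < i by omega)
    omega
  have hmaps : Set.MapsTo σ (Set.Icc 1 n) (Set.Icc 1 n) := by
    rintro p ⟨h1, h2⟩
    rcases hcases p h1 with ⟨i, hi, rfl⟩ | ⟨i, hi, rfl⟩ | h
    · rw [hσeven i hi]; simpa using hSn (hsS i hi)
    · rw [hσodd i hi.le]; exact ⟨htpos _ (by omega), htn _ (by omega)⟩
    · rw [hσbig p h]; exact ⟨htpos _ (by omega), htn _ (by omega)⟩
  have hne : ∀ i < k, ∀ j, s i ≠ t j := fun i hi j h => htS j (h ▸ hsS i hi)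
  have hinj : Set.InjOn σ (Set.Icc 1 n) := by
    rintro p ⟨h1, h2⟩ q ⟨h3, h4⟩ hpq
    rcases hcases p h1 with ⟨i, hi, rfl⟩ | ⟨i, hi, rfl⟩ | h <;>
    rcases hcases q h3 with ⟨j, hj, rfl⟩ | ⟨j, hj, rfl⟩ | h'
    · rw [hσeven i hi, hσeven j hj] at hpq
      have := hsinj i hi j hj hpq; omega
    · rw [hσeven i hi, hσodd j hj.le] at hpq
      exact absurd hpq (hne i hi _)
    · rw [hσeven i hi, hσbig q h'] at hpq
      exact absurd hpq (hne i hi _)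
    · rw [hσodd i hi.le, hσeven j hj] at hpq
      exact absurd hpq.symm (hne j hj _)
    · rw [hσodd i hi.le, hσodd j hj.le] at hpq
      have := htmono.injective hpq; omega
    · rw [hσodd i hi.le, hσbig q h'] at hpq
      have := htmono.injective hpq; omega
    · rw [hσbig p h, hσeven j hj] at hpq
      exact absurd hpq.symm (hne j hj _)
    · rw [hσbig p h, hσodd j hj.le] at hpq
      have := htmono.injective hpq; omega
    · rw [hσbig p h, hσbig q h'] at hpq
      have := htmono.injective hpq; omega
  have hperm : IsPermOn n σ :=
    ⟨hmaps, hinj, by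
      rw [← Finset.coe_Icc] at *
      exact Finset.surjOn_of_injOn_of_card_le σ hmaps hinj le_rfl⟩
  refine ⟨σ, hperm, ?_⟩
  ext x
  simp only [CP, Finset.mem_image, Finset.mem_filter, Finset.mem_Icc]
  constructor
  · rintro ⟨p, ⟨⟨h1, h2⟩, h3, h4⟩, rfl⟩
    rcases hcases p (by omega) with ⟨i, hi, rfl⟩ | ⟨i, hi, rfl⟩ | h
    · rw [hσeven i hi]; exact hsS i hi
    · rw [hσodd i hi.le, hσeven i hi] at h4
      have h5 := hst i hi
      have h6 := htmono (show i + 1 < i + 2 by omega)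
      omega
    · rw [hσbig p h, hσbig (p + 1) (by omega)] at h4
      have := htmono (show p - k < p + 1 - k by omega)
      omega
  · intro hx
    obtain ⟨i, hi, rfl⟩ := hssurj x hx
    have h5 := hst i hi
    have h6 := htmono (show i + 1 < i + 2 by omega)
    refine ⟨2 * i + 2, ⟨⟨by omega, by omega⟩, ?_, ?_⟩, hσeven i hi⟩
    · rw [hσeven i hi, show 2 * i + 2 - 1 = 2 * i + 1 by omega, hσodd i hi.le]; omega
    · rw [hσeven i hi, show 2 * i + 2 + 1 = 2 * (i + 1) + 1 by omega, hσodd (i + 1) hi]; omega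

/-- Circular peak sets of permutations of `[n]` are exactly the strict ballot subsets. -/
theorem Pn_eq_ballotSets {n : ℕ} (hn : 1 ≤ n) : Pn n = ballotSets n := by
  ext S
  simp only [Pn, Finset.mem_filter, Finset.mem_powerset]
  constructor
  · rintro ⟨hS, σ, hσ, rfl⟩
    exact mem_ballotSets.2 ⟨hS, fun j hj =>
      two_mul_card_inter_CP_lt hσ (Finset.mem_Icc.1 hj).1⟩
  · exact fun hS => ⟨(mem_ballotSets.1 hS).1, exists_isPermOn_CP_eq hn hS⟩

/-- The number of chains `S₀ ⊂ S₁ ⊂ ⋯ ⊂ S_j` of finite sets whose top `S_j` is a fixed set with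
`m` elements. -/
def flagCount : ℕ → ℕ → ℕ
  | 0, _ => 1
  | j + 1, m => ∑ l ∈ Finset.range m, m.choose l * flagCount j l

/-- The chains (under inclusion) of `j + 1` finite sets whose top is `S`. -/
def flagsBelow : ℕ → Finset ℕ → Finset (Finset (Finset ℕ))
  | 0, S => {{S}}
  | j + 1, S => S.ssubsets.biUnion fun T => (flagsBelow j T).image (insert S)

lemma mem_flagsBelow {j : ℕ} {S : Finset ℕ} {C : Finset (Finset ℕ)} : C ∈ flagsBelow j S ↔
    C.card = j + 1 ∧ S ∈ C ∧ (∀ T ∈ C, T ⊆ S) ∧ ∀ T ∈ C, ∀ U ∈ C, T ⊆ U ∨ U ⊆ T := by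
  induction j generalizing S C with
  | zero =>
    rw [flagsBelow, Finset.mem_singleton]
    constructor
    · rintro rfl; simp
    · rintro ⟨h, hS, -, -⟩
      obtain ⟨T, rfl⟩ := Finset.card_eq_one.1 h
      rw [Finset.mem_singleton.1 hS]
  | succ j ih =>
    simp only [flagsBelow, Finset.mem_biUnion, Finset.mem_image, Finset.mem_ssubsets, ih]
    constructor
    · rintro ⟨T, hTS, D, ⟨hcard, hTD, hle, hchain⟩, rfl⟩
      have hle' : ∀ U ∈ D, U ⊆ S := fun U hU => (hle U hU).trans hTS.subset
      have hS : S ∉ D := fun h => hTS.not_subset (hle S h)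
      refine ⟨by rw [Finset.card_insert_of_notMem hS, hcard], Finset.mem_insert_self _ _, ?_, ?_⟩
      · intro U hU
        rcases Finset.mem_insert.1 hU with rfl | hU
        · exact subset_rfl
        · exact hle' U hU
      · intro U hU V hV
        rw [Finset.mem_insert] at hU hV
        rcases hU with rfl | hU
        · rcases hV with rfl | hV
          · exact Or.inl subset_rfl
          · exact Or.inr (hle' V hV)
        · rcases hV with rfl | hV
          · exact Or.inl (hle' U hU)
          · exact hchain U hU V hV
    · rintro ⟨hcard, hS, hle, hchain⟩
      have hcard' : (C.erase S).card = j + 1 := by rw [Finset.card_erase_of_mem hS, hcard]; rfl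
      have hne : (C.erase S).Nonempty := Finset.card_pos.1 (by omega)
      obtain ⟨T, hT, hmax⟩ := (C.erase S).exists_max_image Finset.card hne
      have hTC := Finset.mem_of_mem_erase hT
      refine ⟨T, (hle T hTC).ssubset_of_ne (Finset.ne_of_mem_erase hT), C.erase S,
        ⟨hcard', hT, fun U hU => ?_, fun U hU V hV =>
          hchain U (Finset.mem_of_mem_erase hU) V (Finset.mem_of_mem_erase hV)⟩,
        Finset.insert_erase hS⟩
      rcases hchain T hTC U (Finset.mem_of_mem_erase hU) with h | h
      · exact (Finset.eq_of_subset_of_card_le h (hmax U hU)).symm.subset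
      · exact h

lemma pairwiseDisjoint_flagsBelow (j : ℕ) (s : Set (Finset ℕ)) :
    s.PairwiseDisjoint (flagsBelow j) := by
  intro S _ T _ hST
  rw [Function.onFun, Finset.disjoint_left]
  intro C hC hC'
  rw [mem_flagsBelow] at hC hC'
  exact hST ((hC'.2.2.1 S hC.2.1).antisymm (hC.2.2.1 T hC'.2.1))

lemma card_flagsBelow (j : ℕ) (S : Finset ℕ) : (flagsBelow j S).card = flagCount j S.card := by
  induction j generalizing S with
  | zero => simp [flagsBelow, flagCount]
  | succ j ih =>
    have hnot : ∀ T ∈ S.ssubsets, ∀ D ∈ flagsBelow j T, S ∉ D := fun T hT D hD h =>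
      (Finset.mem_ssubsets.1 hT).not_subset ((mem_flagsBelow.1 hD).2.2.1 S h)
    rw [flagsBelow, Finset.card_biUnion]
    · have : ∀ T ∈ S.ssubsets, ((flagsBelow j T).image (insert S)).card = flagCount j T.card := by
        intro T hT
        rw [Finset.card_image_of_injOn, ih]
        intro D hD D' hD' h
        rw [← Finset.erase_insert (hnot T hT D hD), ← Finset.erase_insert (hnot T hT D' hD')]
        exact congrArg (fun U => Finset.erase U S) h
      rw [Finset.sum_congr rfl this, flagCount]
      have h1 := Finset.sum_powerset_apply_card (flagCount j) (x := S)
      rw [← Finset.add_sum_erase _ _ (Finset.mem_powerset_self S), Finset.sum_range_succ,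
        Nat.choose_self, one_smul, add_comm] at h1
      exact Nat.add_right_cancel h1
    · intro T hT T' hT' hne
      rw [Function.onFun, Finset.disjoint_left]
      intro C hC hC'
      obtain ⟨D, hD, rfl⟩ := Finset.mem_image.1 hC
      obtain ⟨E, hE, h⟩ := Finset.mem_image.1 hC'
      have : E = D := by
        rw [← Finset.erase_insert (hnot T hT D hD), ← Finset.erase_insert (hnot T' hT' E hE), h]
      subst this
      exact Finset.disjoint_left.1
        (pairwiseDisjoint_flagsBelow j Set.univ (Set.mem_univ T) (Set.mem_univ T') hne) hD hE

/-- The number of `(j + 1)`-element chains of strict ballot subsets of `[n]`. -/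
lemma card_chains_ballotSets (n j : ℕ) :
    Nat.card {C : Finset {S : Finset ℕ // S ∈ ballotSets n} // C.card = j + 1 ∧
      ∀ S ∈ C, ∀ T ∈ C, S ≠ T → ¬ (¬ S.val ⊆ T.val ∧ ¬ T.val ⊆ S.val)} =
    ∑ S ∈ ballotSets n, flagCount j S.card := by
  classical
  rw [Nat.card_eq_fintype_card, Fintype.card_subtype,
    ← Finset.card_map (Finset.mapEmbedding (Function.Embedding.subtype _)).toEmbedding]
  simp_rw [← card_flagsBelow]
  rw [← Finset.card_biUnion fun S hS T hT h =>
    pairwiseDisjoint_flagsBelow j Set.univ (Set.mem_univ S) (Set.mem_univ T) h]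
  congr 1
  ext C
  simp only [Finset.mem_map, Finset.mem_filter, Finset.mem_univ, true_and, Finset.mem_biUnion,
    mem_flagsBelow]
  constructor
  · rintro ⟨D, ⟨hcard, hchain⟩, rfl⟩
    have hchain' : ∀ S ∈ D, ∀ T ∈ D, S.1 ⊆ T.1 ∨ T.1 ⊆ S.1 := by
      intro S hS T hT
      by_cases h : S = T
      · exact Or.inl (h ▸ subset_rfl)
      · have := hchain S hS T hT h
        tauto
    obtain ⟨S, hS, hmax⟩ := D.exists_max_image (fun S => S.1.card)
      (Finset.card_pos.1 (by omega))
    refine ⟨S.1, S.2, by simpa using hcard, by simpa using hS, ?_, ?_⟩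
    · intro T hT
      obtain ⟨T, hTD, rfl⟩ := Finset.mem_map.1 hT
      rcases hchain' S hS T hTD with h | h
      · exact (Finset.eq_of_subset_of_card_le h (hmax T hTD)).symm.subset
      · exact h
    · intro T hT U hU
      obtain ⟨T, hTD, rfl⟩ := Finset.mem_map.1 hT
      obtain ⟨U, hUD, rfl⟩ := Finset.mem_map.1 hU
      exact hchain' T hTD U hUD
  · rintro ⟨S, hS, hcard, -, hle, hchain⟩
    have hmem : ∀ T ∈ C, T ∈ ballotSets n := fun T hT => ballotSets_of_subset hS (hle T hT)
    have hmap := Finset.subtype_map_of_mem hmem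
    refine ⟨C.subtype (· ∈ ballotSets n), ⟨?_, ?_⟩, hmap⟩
    · rw [← Finset.card_map (Function.Embedding.subtype _), hmap, hcard]
    · intro T hT U hU _
      have := hchain T (Finset.mem_subtype.1 hT) U (Finset.mem_subtype.1 hU)
      tauto

lemma sum_piAntidiag_univ_snoc {M : Type*} [AddCommMonoid M] (j n : ℕ)
    (F : (Fin (j + 1) → ℕ) → M) :
    ∑ d ∈ Finset.piAntidiag Finset.univ n, F d =
      ∑ l ∈ Finset.range (n + 1), ∑ d ∈ Finset.piAntidiag (Finset.univ : Finset (Fin j)) l,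
        F (Fin.snoc d (n - l) : Fin (j + 1) → ℕ) := by
  rw [Finset.sum_sigma']
  symm
  refine Finset.sum_nbij' (fun x => (Fin.snoc x.2 (n - x.1) : Fin (j + 1) → ℕ))
    (fun d => ⟨∑ k, Fin.init d k, Fin.init d⟩) ?_ ?_ ?_ ?_ ?_
  · rintro ⟨l, d⟩ h
    simp only [Finset.mem_sigma, Finset.mem_range, Finset.mem_piAntidiag] at h
    simp only [Finset.mem_piAntidiag, Fin.sum_univ_castSucc, Fin.snoc_castSucc, Fin.snoc_last]
    have h' : ∑ k, d k = l := h.2.1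
    exact ⟨by omega, by simp⟩
  · intro d h
    simp only [Finset.mem_piAntidiag, Fin.sum_univ_castSucc] at h
    simp only [Finset.mem_sigma, Finset.mem_range, Finset.mem_piAntidiag, Fin.init]
    exact ⟨by omega, rfl, by simp⟩
  · rintro ⟨l, d⟩ h
    simp only [Finset.mem_sigma, Finset.mem_range, Finset.mem_piAntidiag] at h
    simp [h.2.1]
  · intro d h
    simp only [Finset.mem_piAntidiag, Fin.sum_univ_castSucc] at h
    have : n - ∑ k, Fin.init d k = d (Fin.last j) := by
      simp only [Fin.init]; omega
    simp [this]
  · intros; rfl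

lemma multinomial_univ_snoc {j : ℕ} (d : Fin j → ℕ) (e : ℕ) :
    Nat.multinomial Finset.univ (Fin.snoc d e : Fin (j + 1) → ℕ) =
      (∑ k, d k + e).choose (∑ k, d k) * Nat.multinomial Finset.univ d := by
  have h1 := Nat.multinomial_spec Finset.univ (Fin.snoc d e : Fin (j + 1) → ℕ)
  have h2 := Nat.multinomial_spec Finset.univ d
  have h3 := Nat.add_choose_mul_factorial_mul_factorial (∑ k, d k) e
  simp only [Fin.sum_univ_castSucc, Fin.prod_univ_castSucc, Fin.snoc_castSucc, Fin.snoc_last] at h1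
  have hpos : 0 < (∏ k, (d k).factorial) * e.factorial :=
    Nat.mul_pos (Finset.prod_pos fun k _ => Nat.factorial_pos _) (Nat.factorial_pos _)
  apply Nat.eq_of_mul_eq_mul_left hpos
  rw [h1, ← h3, ← h2, Nat.choose_symm_add]
  ring

lemma sum_multinomial_eq_flagCount (j m : ℕ) :
    ∑ d ∈ Finset.piAntidiag (Finset.univ : Finset (Fin (j + 1))) m,
      (if ∀ k : Fin (j + 1), 1 ≤ (k : ℕ) → 1 ≤ d k then Nat.multinomial Finset.univ d else 0) =
    flagCount j m := by
  induction j generalizing m with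
  | zero =>
    have : Finset.piAntidiag (Finset.univ : Finset (Fin 1)) m = {fun _ => m} := by
      ext d
      simp only [Finset.mem_piAntidiag, Finset.mem_singleton, funext_iff, Fin.forall_fin_one]
      simp
    rw [this, Finset.sum_singleton, if_pos (by simp)]
    simp [flagCount]
  | succ j ih =>
    rw [sum_piAntidiag_univ_snoc, flagCount, Finset.sum_range_succ]
    rw [Finset.sum_eq_zero (s := Finset.piAntidiag _ m), add_zero]
    · refine Finset.sum_congr rfl fun l hl => ?_
      have hl := Finset.mem_range.1 hl
      rw [← ih, Finset.mul_sum]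
      refine Finset.sum_congr rfl fun d hd => ?_
      have hd := (Finset.mem_piAntidiag.1 hd).1
      rw [multinomial_univ_snoc, hd, Nat.add_sub_cancel' hl.le, mul_ite, mul_zero]
      refine if_congr ?_ rfl rfl
      rw [Fin.forall_fin_succ']
      simp only [Fin.snoc_castSucc, Fin.snoc_last, Fin.val_castSucc]
      exact and_iff_left fun _ => by omega
    · intro d _
      refine if_neg fun h => ?_
      have := h (Fin.last _) (by simp)
      simp at this

lemma sum_ballotSets_flagCount {n : ℕ} (hn : 1 ≤ n) (j : ℕ) :
    ∑ S ∈ ballotSets n, flagCount j S.card =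
      ∑ l ∈ Finset.range (n + 1), ballotCount n l * flagCount j l := by
  rw [← Finset.sum_fiberwise_of_maps_to (g := Finset.card) (t := Finset.range (n + 1))]
  · refine Finset.sum_congr rfl fun l _ => ?_
    rw [Finset.sum_congr rfl fun S hS => by rw [(Finset.mem_filter.1 hS).2], Finset.sum_const,
      smul_eq_mul, ballotCount]
  · intro S hS
    have := two_mul_card_lt_of_mem_ballotSets hn hS
    simp; omega

lemma sum_multinomial_mul_eq_sum_ballotCount {n : ℕ} (hn : 1 ≤ n) (j : ℕ) :
    ∑ d ∈ (Fintype.piFinset fun _ : Fin (j + 1 + 1) => Finset.range (n + 1)).filter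
        (fun d => (∑ k, d k) = n ∧
          (∀ k : Fin (j + 1 + 1), 1 ≤ (k : ℕ) → (k : ℕ) ≤ j + 1 - 1 → 1 ≤ d k) ∧
          n - (n - 1) / 2 ≤ d (Fin.last (j + 1))),
      (Nat.multinomial Finset.univ d : ℚ) *
        (2 * (d (Fin.last (j + 1)) : ℚ) - (n : ℚ)) / (n : ℚ) =
    ∑ l ∈ Finset.range (n + 1), (ballotCount n l : ℚ) * flagCount j l := by
  have hset : (Fintype.piFinset fun _ : Fin (j + 1 + 1) => Finset.range (n + 1)).filter
        (fun d => (∑ k, d k) = n ∧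
          (∀ k : Fin (j + 1 + 1), 1 ≤ (k : ℕ) → (k : ℕ) ≤ j + 1 - 1 → 1 ≤ d k) ∧
          n - (n - 1) / 2 ≤ d (Fin.last (j + 1))) =
      (Finset.piAntidiag Finset.univ n).filter (fun d =>
          (∀ k : Fin (j + 1 + 1), 1 ≤ (k : ℕ) → (k : ℕ) ≤ j + 1 - 1 → 1 ≤ d k) ∧
          n - (n - 1) / 2 ≤ d (Fin.last (j + 1))) := by
    ext d
    simp only [Finset.mem_filter, Fintype.mem_piFinset, Finset.mem_range, Finset.mem_piAntidiag]
    constructor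
    · rintro ⟨-, h1, h2⟩
      exact ⟨⟨h1, by simp⟩, h2⟩
    · rintro ⟨⟨h1, -⟩, h2⟩
      refine ⟨fun k => ?_, h1, h2⟩
      have := Finset.single_le_sum (f := d) (fun _ _ => Nat.zero_le _) (Finset.mem_univ k)
      have h' : ∑ k, d k = n := h1
      omega
  rw [hset, Finset.sum_filter, sum_piAntidiag_univ_snoc]
  refine Finset.sum_congr rfl fun l hl => ?_
  have hl := Finset.mem_range.1 hl
  by_cases hln : n ≤ 2 * l
  · rw [ballotCount_eq_zero hn hln, Nat.cast_zero, zero_mul]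
    refine Finset.sum_eq_zero fun d _ => if_neg fun h => ?_
    have := h.2
    rw [Fin.snoc_last] at this
    omega
  · rw [ballotCount_eq hn (by omega), ← sum_multinomial_eq_flagCount, Nat.cast_sum,
      Finset.mul_sum]
    refine Finset.sum_congr rfl fun d hd => ?_
    have hd := (Finset.mem_piAntidiag.1 hd).1
    rw [multinomial_univ_snoc, hd, Nat.add_sub_cancel' (by omega), Fin.snoc_last,
      Nat.cast_ite, Nat.cast_zero, mul_ite, mul_zero]
    refine if_congr ?_ ?_ rfl
    · rw [Fin.forall_fin_succ']
      simp only [Fin.snoc_castSucc, Fin.snoc_last, Fin.val_castSucc]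
      constructor
      · rintro ⟨⟨h, -⟩, -⟩ k hk
        exact h k hk (by omega)
      · intro h
        refine ⟨⟨fun k hk _ => h k hk, fun _ _ => by omega⟩, by omega⟩
    · rw [Nat.cast_sub (by omega)]
      push_cast
      ring

/-- Theorem 4.3: the Hilbert function of the algebra `B_{P_n} = K[x_S : S ∈ P_n]/J`,
where `J` is generated by the products `x_S·x_T` over incomparable pairs together with
all squares `x_S²`: for `1 ≤ i ≤ ⌊(n−1)/2⌋ + 1`, `dim_K B_{P_n}^i` equals
`Σ multinomial(n; d_1, …, d_{i+1})·(2d_{i+1} − n)/n`, the sum ranging over all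
`(d_1, …, d_{i+1})` with `Σ d_k = n`, `d_1 ≥ 0`, `d_k ≥ 1` for `2 ≤ k ≤ i`, and
`d_{i+1} ≥ n − ⌊(n−1)/2⌋`. -/
theorem hilbert_series_B (n : ℕ) (hn : 3 ≤ n) (K : Type*) [Field K]
    (i : ℕ) (hi1 : 1 ≤ i) (hi2 : i ≤ (n - 1) / 2 + 1) :
    (Module.finrank K
      (Submodule.map
        (Ideal.Quotient.mkₐ K
          (Ideal.span ({p : MvPolynomial {S : Finset ℕ // S ∈ Pn n} K |
            ∃ S T : {S : Finset ℕ // S ∈ Pn n},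
              (¬ S.val ⊆ T.val ∧ ¬ T.val ⊆ S.val) ∧
              p = MvPolynomial.X S * MvPolynomial.X T} ∪
            {p : MvPolynomial {S : Finset ℕ // S ∈ Pn n} K |
              ∃ S : {S : Finset ℕ // S ∈ Pn n},
                p = MvPolynomial.X S ^ 2}))).toLinearMap
        (MvPolynomial.homogeneousSubmodule {S : Finset ℕ // S ∈ Pn n} K i)) : ℚ) =
      ∑ d ∈ (Fintype.piFinset fun _ : Fin (i + 1) => Finset.range (n + 1)).filter
          (fun d => (∑ k, d k) = n ∧
            (∀ k : Fin (i + 1), 1 ≤ (k : ℕ) → (k : ℕ) ≤ i - 1 → 1 ≤ d k) ∧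
            n - (n - 1) / 2 ≤ d (Fin.last i)),
        (Nat.multinomial Finset.univ d : ℚ) *
          (2 * (d (Fin.last i) : ℚ) - (n : ℚ)) / (n : ℚ) := by
  obtain ⟨j, rfl⟩ := Nat.exists_eq_add_of_le' hi1
  rw [sum_multinomial_mul_eq_sum_ballotCount (by omega) j,
    finrank_map_homogeneousSubmodule_eq_card
      (fun S T : {S : Finset ℕ // S ∈ Pn n} => ¬ S.val ⊆ T.val ∧ ¬ T.val ⊆ S.val),
    Pn_eq_ballotSets (by omega), card_chains_ballotSets, sum_ballotSets_flagCount (by omega)]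
  push_cast
  rfl
end
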